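/- arXiv:2501.00429 — 2 statements merged into one kernel-verified Lean document; each statement's English description precedes it below -/
import Mathlib

section
/- Let V : ℝ^d → ℝ satisfy Assumptions 1–3 with min V = 0, let δ₀, g₀, μ⁻, M_Δ, L, ν be the constants described in the context with the set X of local maxima nonempty, and set C = 4M_Δ/ν² and U = {x ∈ ℝ^d : dist(x,S) ≤ √(Cε)}. Suppose ε ≤ min{ν_eb²/(64 C_g), δ₀²/C, g₀²/(4M_Δ)} and additionally ε is small enough that d·μ⁻/(2ε) ≤ ν_eb²R₀²/(128 ε²). If the uniform (normalized Lebesgue) measure on U satisfies the Poincaré inequality PI(λ), then the Gibbs measure μ_ε satisfies the Poincaré inequality with constant at least (1/2)·(dμ⁻/(dμ⁻ + M_Δ))·exp(−4LC)·λ. -/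
open MeasureTheory Real Filter Metric Set
open scoped RealInnerProductSpace ENNReal Topology

noncomputable section

abbrev Euc (n : ℕ) := EuclideanSpace ℝ (Fin n)

variable {d : ℕ}

def localMinSet (V : Euc d → ℝ) : Set (Euc d) := {x | IsLocalMin V x}

def localMaxSet (V : Euc d → ℝ) : Set (Euc d) := {x | IsLocalMax V x}

def hessQ (V : Euc d → ℝ) (x v : Euc d) : ℝ := ⟪fderiv ℝ (gradient V) x v, v⟫

def lap (V : Euc d → ℝ) (x : Euc d) : ℝ :=
  ∑ i, hessQ V x (EuclideanSpace.basisFun (Fin d) ℝ i)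

def PoincareIneq {d : ℕ} (μ : Measure (Euc d)) (ρ : ℝ) : Prop :=
  ∀ f : Euc d → ℝ, ContDiff ℝ 1 f →
    Integrable (fun x => (f x) ^ 2) μ →
    Integrable (fun x => ‖gradient f x‖ ^ 2) μ →
    ∫ x, (f x - ∫ y, f y ∂μ) ^ 2 ∂μ ≤ (1 / ρ) * ∫ x, ‖gradient f x‖ ^ 2 ∂μ

def gibbs (V : Euc d → ℝ) (ε : ℝ) : Measure (Euc d) :=
  (ENNReal.ofReal (∫ x, exp (-V x / ε)))⁻¹ •
    volume.withDensity fun x => ENNReal.ofReal (exp (-V x / ε))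

def gibbsOn (V : Euc d → ℝ) (ε : ℝ) (U : Set (Euc d)) : Measure (Euc d) :=
  (ENNReal.ofReal (∫ x in U, exp (-V x / ε)))⁻¹ •
    (volume.restrict U).withDensity fun x => ENNReal.ofReal (exp (-V x / ε))

def uniformOn {d : ℕ} (U : Set (Euc d)) : Measure (Euc d) :=
  (volume U)⁻¹ • volume.restrict U

def Assumption1 (V : Euc d → ℝ) (ν : ℝ) (𝒩 : Set (Euc d) → Set (Euc d)) : Prop :=
  0 < ν ∧ ∀ x ∈ localMinSet V,
    IsOpen (𝒩 (connectedComponentIn (localMinSet V) x)) ∧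
    connectedComponentIn (localMinSet V) x ⊆ 𝒩 (connectedComponentIn (localMinSet V) x) ∧
    ContDiffOn ℝ 3 V (𝒩 (connectedComponentIn (localMinSet V) x)) ∧
    ∀ y ∈ 𝒩 (connectedComponentIn (localMinSet V) x),
      ν * (V y - sInf (V '' 𝒩 (connectedComponentIn (localMinSet V) x))) ≤ ‖gradient V y‖ ^ 2

def NSet (V : Euc d → ℝ) (𝒩 : Set (Euc d) → Set (Euc d)) : Set (Euc d) :=
  ⋃ x ∈ localMinSet V, 𝒩 (connectedComponentIn (localMinSet V) x)

def Assumption2 (V : Euc d → ℝ) (𝒩 : Set (Euc d) → Set (Euc d)) : Prop :=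
  ∀ x ∉ NSet V 𝒩, gradient V x = 0 → ∀ v : Euc d, v ≠ 0 → hessQ V x v < 0

def Assumption3 (V : Euc d → ℝ) (R₀ ν_eb C_g : ℝ) : Prop :=
  0 < R₀ ∧ 0 < ν_eb ∧ 0 < C_g ∧
  (∀ x : Euc d, R₀ ≤ ‖x‖ →
      ν_eb * infDist x (localMinSet V) ≤ ‖gradient V x‖ ∧ |lap V x| ≤ C_g * ‖x‖ ^ 2) ∧
  Tendsto V (cocompact (Euc d)) atTop ∧
  localMinSet V ⊆ closedBall 0 R₀

theorem aux_grad_contDiff {n : ℕ} {V : Euc d → ℝ} (hV : ContDiff ℝ (n + 1) V) :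
    ContDiff ℝ n (gradient V) := by
  have h : ContDiff ℝ n (fderiv ℝ V) := hV.fderiv_right le_rfl
  exact (InnerProductSpace.toDual ℝ (Euc d)).symm.contDiff.comp h

theorem aux_grad1 {V : Euc d → ℝ} (hV : ContDiff ℝ 2 V) : ContDiff ℝ 1 (gradient V) := by
  have := aux_grad_contDiff (n := 1) (V := V) (by exact_mod_cast hV)
  exact_mod_cast this

theorem aux_grad0 {V : Euc d → ℝ} (hV : ContDiff ℝ 1 V) : Continuous (gradient V) := by
  have := aux_grad_contDiff (n := 0) (V := V) (by simpa using hV)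
  exact this.continuous

theorem aux_line {V : Euc d → ℝ} (hV : ContDiff ℝ 1 V) (x v : Euc d) (t : ℝ) :
    HasDerivAt (fun s : ℝ => V (x + s • v)) ⟪gradient V (x + t • v), v⟫ t := by
  have h1 : HasFDerivAt V (fderiv ℝ V (x + t • v)) (x + t • v) :=
    (hV.differentiable one_ne_zero).differentiableAt.hasFDerivAt
  have h2 : HasDerivAt (fun s : ℝ => x + s • v) v t := by
    simpa using ((hasDerivAt_id t).smul_const v).const_add x
  have h3 := h1.comp_hasDerivAt t h2
  rw [inner_gradient_left]
  exact h3

theorem aux_fderiv_grad {V : Euc d → ℝ} (hV : ContDiff ℝ 2 V) (x v w : Euc d) :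
    ⟪fderiv ℝ (gradient V) x v, w⟫ = fderiv ℝ (fderiv ℝ V) x v w := by
  have h1 : HasFDerivAt (gradient V) (fderiv ℝ (gradient V) x) x :=
    ((aux_grad1 hV).differentiable one_ne_zero).differentiableAt.hasFDerivAt
  have h2 := ((InnerProductSpace.toDual ℝ (Euc d)).toContinuousLinearEquiv.hasFDerivAt).comp x h1
  have h3 : (fderiv ℝ V) = (InnerProductSpace.toDual ℝ (Euc d)).toContinuousLinearEquiv ∘ gradient V := by
    funext y
    exact toDual_gradient.symm
  rw [h3, h2.fderiv]
  rfl

theorem aux_symm {V : Euc d → ℝ} (hV : ContDiff ℝ 2 V) (x v w : Euc d) :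
    ⟪fderiv ℝ (gradient V) x v, w⟫ = ⟪fderiv ℝ (gradient V) x w, v⟫ := by
  rw [aux_fderiv_grad hV, aux_fderiv_grad hV]
  exact (hV.contDiffAt.isSymmSndFDerivAt (by simp)) v w

/-- if hessQ x v < 0 and gradient zero then V strictly below near x on the ray. -/
theorem aux_ray {V : Euc d → ℝ} (hV : ContDiff ℝ 2 V) (x v : Euc d) (δ : ℝ)
    (h : ∀ t ∈ Ioo (0 : ℝ) δ, ⟪gradient V (x + t • v), v⟫ < 0) (t : ℝ) (ht : t ∈ Ioo 0 δ) :
    V (x + t • v) < V x := by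
  have hV1 : ContDiff ℝ 1 V := hV.of_le (by norm_num)
  have : StrictAntiOn (fun s : ℝ => V (x + s • v)) (Icc 0 t) := by
    apply strictAntiOn_of_deriv_neg (convex_Icc _ _)
    · exact (hV.continuous.comp (by fun_prop)).continuousOn
    · intro s hs
      rw [interior_Icc] at hs
      rw [(aux_line hV1 x v s).deriv]
      exact h s ⟨hs.1, hs.2.trans ht.2⟩
  have := this (left_mem_Icc.2 ht.1.le) (right_mem_Icc.2 ht.1.le) ht.1
  simpa using this

theorem aux_hess_nonneg {V : Euc d → ℝ} (hV : ContDiff ℝ 2 V) (x : Euc d) (hx : IsLocalMin V x)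
    (v : Euc d) : 0 ≤ hessQ V x v := by
  by_contra hneg
  push Not at hneg
  have hg0 : gradient V x = 0 := by
    rw [gradient, hx.fderiv_eq_zero]; simp
  have h1 : HasFDerivAt (gradient V) (fderiv ℝ (gradient V) x) x :=
    ((aux_grad1 hV).differentiable one_ne_zero).differentiableAt.hasFDerivAt
  have h2 : HasDerivAt (fun s : ℝ => x + s • v) v 0 := by
    simpa using ((hasDerivAt_id (0:ℝ)).smul_const v).const_add x
  have h3 : HasDerivAt (fun s : ℝ => gradient V (x + s • v)) (fderiv ℝ (gradient V) x v) 0 := by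
    have h1' : HasFDerivAt (gradient V) (fderiv ℝ (gradient V) x) (x + (0:ℝ) • v) := by simpa using h1
    exact h1'.comp_hasDerivAt (0:ℝ) h2
  have h4 : HasDerivAt (fun s : ℝ => ⟪gradient V (x + s • v), v⟫) (hessQ V x v) 0 := by
    have := h3.inner ℝ (hasDerivAt_const (0:ℝ) v)
    simpa [hessQ] using this
  have h5 : ∀ᶠ s in 𝓝[>] (0:ℝ), ⟪gradient V (x + s • v), v⟫ < 0 := by
    have := (h4.tendsto_slope.mono_left (nhdsWithin_mono _ (fun s (hs : 0 < s) => hs.ne'))).eventually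
      (gt_mem_nhds hneg)
    filter_upwards [this, self_mem_nhdsWithin] with s hs hs0
    simp only [slope_def_field, zero_smul, add_zero, hg0, inner_zero_left, sub_zero] at hs
    have hs0' : 0 < s := hs0
    by_contra hc
    push Not at hc
    exact absurd hs (not_lt.2 (div_nonneg hc hs0'.le))
  obtain ⟨δ, hδ, h6⟩ := mem_nhdsGT_iff_exists_Ioo_subset.1 h5
  have h7 : ∀ᶠ s in 𝓝[>] (0:ℝ), V x ≤ V (x + s • v) := by
    have hc : Tendsto (fun s : ℝ => x + s • v) (𝓝[>] 0) (𝓝 x) := by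
      have := h2.continuousAt.tendsto.mono_left (nhdsWithin_le_nhds (s := Ioi (0:ℝ)))
      simpa using this
    exact hc.eventually hx
  obtain ⟨s, hs1, hs2⟩ := (h7.and (Ioo_mem_nhdsGT (show (0:ℝ) < δ from hδ))).exists
  exact absurd (aux_ray hV x v δ (fun t ht => h6 ht) s hs2) (not_lt.2 hs1)

theorem aux_strict_max {V : Euc d → ℝ} (hV : ContDiff ℝ 2 V) (x : Euc d)
    (hg0 : gradient V x = 0) (hneg : ∀ v : Euc d, v ≠ 0 → hessQ V x v < 0) :
    ∃ δ > 0, ∀ y ∈ ball x δ, y ≠ x → V y < V x := by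
  -- uniform negativity
  obtain ⟨η, hη, hQ⟩ : ∃ η > 0, ∀ v : Euc d, hessQ V x v ≤ - η * ‖v‖ ^ 2 := by
    have hcont : Continuous (fun v => hessQ V x v) := by unfold hessQ; fun_prop
    rcases (sphere (0 : Euc d) 1).eq_empty_or_nonempty with he | hne
    · refine ⟨1, one_pos, fun v => ?_⟩
      have : v = 0 := by
        by_contra hv
        have : (‖v‖⁻¹ • v) ∈ sphere (0 : Euc d) 1 := by
          simp [norm_smul, hv]
        rw [he] at this; exact this
      subst this; simp [hessQ]
    · obtain ⟨v0, hv0, hmax⟩ := (isCompact_sphere (0 : Euc d) 1).exists_isMaxOn hne hcont.continuousOn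
      have hv0' : v0 ≠ 0 := by
        rintro rfl; simp at hv0
      refine ⟨- hessQ V x v0, by linarith [hneg v0 hv0'], fun v => ?_⟩
      by_cases hv : v = 0
      · subst hv; simp [hessQ]
      have h1 : (‖v‖⁻¹ • v) ∈ sphere (0 : Euc d) 1 := by
        simp [norm_smul, hv]
      have h2 : hessQ V x (‖v‖⁻¹ • v) ≤ hessQ V x v0 := hmax h1
      have h3 : hessQ V x (‖v‖⁻¹ • v) = (‖v‖ ^ 2)⁻¹ * hessQ V x v := by
        simp only [hessQ, map_smul, inner_smul_left, inner_smul_right]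
        simp; ring
      rw [h3, inv_mul_le_iff₀ (by positivity)] at h2
      linarith
  have h1 : HasFDerivAt (gradient V) (fderiv ℝ (gradient V) x) x :=
    ((aux_grad1 hV).differentiable one_ne_zero).differentiableAt.hasFDerivAt
  have h2 := (h1.isLittleO.bound (show 0 < η / 2 by positivity))
  obtain ⟨δ, hδ, hb⟩ := Metric.eventually_nhds_iff_ball.1 h2
  refine ⟨δ, hδ, fun y hy hyx => ?_⟩
  have hyx' : 0 < ‖y - x‖ := norm_pos_iff.2 (sub_ne_zero.2 hyx)
  rw [mem_ball, dist_eq_norm] at hy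
  have h1lt : 1 < δ / ‖y - x‖ := (one_lt_div hyx').2 hy
  have := aux_ray hV x (y - x) (δ / ‖y - x‖) (fun t ht => ?_) 1 ⟨one_pos, h1lt⟩
  · simpa using this
  · have hz : x + t • (y - x) ∈ ball x δ := by
      rw [mem_ball, dist_eq_norm, add_sub_cancel_left, norm_smul, Real.norm_of_nonneg ht.1.le]
      exact (lt_div_iff₀ hyx').1 ht.2
    have h3 := hb _ hz
    rw [hg0, sub_zero, add_sub_cancel_left] at h3
    set w := y - x
    set e := gradient V (x + t • w) - (fderiv ℝ (gradient V) x) (t • w) with he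
    have h4 : ⟪gradient V (x + t • w), w⟫ = ⟪e, w⟫ + t * hessQ V x w := by
      rw [he, inner_sub_left, map_smul, inner_smul_left]; simp [hessQ]
    have h5 : ⟪e, w⟫ ≤ η / 2 * (t * ‖w‖) * ‖w‖ := by
      refine (real_inner_le_norm _ _).trans ?_
      rw [norm_smul, Real.norm_of_nonneg ht.1.le] at h3
      gcongr
    have h6 : t * hessQ V x w ≤ t * (- η * ‖w‖ ^ 2) := by
      have := ht.1.le
      gcongr; exact hQ w
    rw [h4]
    have : 0 < η * t * ‖w‖ ^ 2 := by have := ht.1; positivity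
    nlinarith

theorem aux_norm_le_lap {V : Euc d → ℝ} (hV : ContDiff ℝ 2 V) (x : Euc d)
    (hx : IsLocalMin V x) : ‖fderiv ℝ (gradient V) x‖ ≤ lap V x := by
  set B := fderiv ℝ (gradient V) x with hB
  have hpos : ∀ v, 0 ≤ ⟪B v, v⟫ := fun v => aux_hess_nonneg hV x hx v
  have hsym : ∀ v w, ⟪B v, w⟫ = ⟪B w, v⟫ := fun v w => aux_symm hV x v w
  have hCS : ∀ v w, ⟪B v, w⟫ ^ 2 ≤ ⟪B v, v⟫ * ⟪B w, w⟫ := by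
    intro v w
    have key : ∀ t : ℝ, 0 ≤ ⟪B w, w⟫ * (t * t) + (2 * ⟪B v, w⟫) * t + ⟪B v, v⟫ := by
      intro t
      have := hpos (v + t • w)
      rw [map_add, map_smul, inner_add_left, inner_add_right, inner_add_right, inner_smul_left,
        inner_smul_left, inner_smul_right, inner_smul_right, hsym w v] at this
      simp only [conj_trivial] at this
      nlinarith
    have := discrim_le_zero key
    rw [discrim] at this
    nlinarith
  have hlap : 0 ≤ lap V x := Finset.sum_nonneg fun i _ => hpos _
  refine ContinuousLinearMap.opNorm_le_bound _ hlap fun u => ?_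
  have h1 : ‖B u‖ ^ 2 ≤ ⟪B u, u⟫ * lap V x := by
    rw [← (EuclideanSpace.basisFun (Fin d) ℝ).sum_sq_norm_inner_left (B u), lap, Finset.mul_sum]
    refine Finset.sum_le_sum fun i _ => ?_
    rw [Real.norm_eq_abs, sq_abs]
    exact hCS u _
  have h2 : ⟪B u, u⟫ ≤ ‖B u‖ * ‖u‖ := real_inner_le_norm _ _
  rcases (norm_nonneg (B u)).eq_or_lt with h | h
  · rw [← h]; positivity
  · have : ‖B u‖ * ‖B u‖ ≤ ‖B u‖ * (lap V x * ‖u‖) := by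
      nlinarith [mul_le_mul_of_nonneg_right h2 hlap]
    exact le_of_mul_le_mul_left this h


theorem aux_punctured (hd : 2 ≤ d) (x : Euc d) (δ : ℝ) (hδ : 0 < δ) :
    IsPreconnected (ball x δ \ {x}) := by
  have hr : 1 < Module.rank ℝ (Euc d) := by
    rw [← Module.finrank_eq_rank, finrank_euclideanSpace_fin]
    exact_mod_cast hd
  have h := (isConnected_compl_singleton_of_one_lt_rank hr (0 : Euc d)).isPreconnected
  have hc : Continuous (fun v : Euc d => x + (δ / (1 + ‖v‖)) • v) := by
    have : ∀ v : Euc d, 1 + ‖v‖ ≠ 0 := fun v => by positivity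
    fun_prop (disch := exact this _)
  have := h.image _ hc.continuousOn
  convert this using 1
  ext y
  simp only [Set.mem_sdiff, mem_ball, mem_singleton_iff, mem_image, mem_compl_iff]
  constructor
  · rintro ⟨h1, h2⟩
    rw [dist_eq_norm] at h1
    have h3 : 0 < δ - ‖y - x‖ := by linarith
    refine ⟨(δ - ‖y - x‖)⁻¹ • (y - x), ?_, ?_⟩
    · simp [h3.ne', sub_ne_zero.2 h2]
    · have : δ / (1 + ‖(δ - ‖y - x‖)⁻¹ • (y - x)‖) * (δ - ‖y - x‖)⁻¹ = 1 := by
        rw [norm_smul, Real.norm_of_nonneg (by positivity)]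
        field_simp
        ring
      rw [smul_smul, this]; simp
  · rintro ⟨v, hv, rfl⟩
    have h1 : 0 < 1 + ‖v‖ := by positivity
    constructor
    · rw [dist_eq_norm, add_sub_cancel_left, norm_smul, Real.norm_of_nonneg (by positivity),
        div_mul_eq_mul_div, div_lt_iff₀ h1]
      nlinarith
    · simp [hv, hδ.ne', h1.ne']

/-- separation of sublevel sets -/
theorem aux_sep {V : Euc d → ℝ} (hV : Continuous V) (hco : Tendsto V (cocompact (Euc d)) atTop)
    (t : ℝ) (A B : Set (Euc d)) (hA : IsClosed A) (hB : IsClosed B) (hAB : Disjoint A B)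
    (hK : {x | V x ≤ t} ⊆ A ∪ B) :
    ∃ s > t, ∀ C : Set (Euc d), IsPreconnected C → C ⊆ {x | V x ≤ s} → 
      ∀ p ∈ C, p ∈ A → ∀ q ∈ C, q ∈ B → False := by
  have hcpt : ∀ s, IsCompact {x | V x ≤ s} := by
    intro s
    have hcl : IsClosed {x | V x ≤ s} := isClosed_le hV continuous_const
    have := hco.eventually (eventually_gt_atTop s)
    obtain ⟨T, hT, hT2⟩ := mem_cocompact.1 this
    refine hT.of_isClosed_subset hcl fun x hx => ?_
    by_contra hc
    have : s < V x := hT2 hc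
    exact absurd hx (not_le.2 this)
  obtain ⟨OA, OB, hOA, hOB, hAO, hBO, hd⟩ := NormalSpace.normal A B hA hB hAB
  have hR : IsCompact ({x | V x ≤ t + 1} \ (OA ∪ OB)) := (hcpt _).diff (hOA.union hOB)
  obtain ⟨s, hs, hs1, hsub⟩ : ∃ s > t, s ≤ t + 1 ∧ {x | V x ≤ s} ⊆ OA ∪ OB := by
    rcases ({x | V x ≤ t + 1} \ (OA ∪ OB)).eq_empty_or_nonempty with he | hne
    · exact ⟨t + 1, by linarith, le_rfl, sdiff_eq_empty.1 he⟩
    · obtain ⟨x0, hx0, hmin⟩ := hR.exists_isMinOn hne hV.continuousOn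
      have hx0t : t < V x0 := by
        by_contra hc
        push Not at hc
        have := hK hc
        exact hx0.2 (union_subset_union hAO hBO this)
      have hx01 : V x0 ≤ t + 1 := hx0.1
      refine ⟨(t + V x0) / 2, by linarith, by linarith, fun x hx => ?_⟩
      by_contra hc
      have hx' : V x ≤ (t + V x0) / 2 := hx
      have hx'' : V x ≤ t + 1 := by linarith
      have : V x0 ≤ V x := hmin ⟨hx'', hc⟩
      linarith
  refine ⟨s, hs, fun C hC hCs p hp hpA q hq hqB => ?_⟩
  have h1 : C ⊆ OA := hC.subset_left_of_subset_union hOA hOB hd (hCs.trans hsub) ⟨p, hp, hAO hpA⟩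
  exact disjoint_left.1 hd (h1 hq) (hBO hqB)

/-- local structure at a regular point -/
theorem aux_regular {V : Euc d → ℝ} (hV : ContDiff ℝ 2 V) (x : Euc d) 
    (hg : gradient V x ≠ 0) :
    ∃ B W : Set (Euc d), IsOpen B ∧ x ∈ B ∧ IsPreconnected W ∧ W ⊆ {y | V y < V x} ∧
      B ∩ {y | V y < V x} ⊆ W ∧ B ∩ {y | V y ≤ V x} ⊆ closure W := by
  have hV1 : ContDiff ℝ 1 V := hV.of_le (by norm_num)
  set g := gradient V x with hgdef
  have hgpos : 0 < ‖g‖ := norm_pos_iff.2 hg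
  have hcont : Continuous (fun z => ⟪gradient V z, g⟫) := (aux_grad0 hV1).inner continuous_const
  have hev : ∀ᶠ z in 𝓝 x, 0 < ⟪gradient V z, g⟫ := by
    apply hcont.continuousAt.eventually (lt_mem_nhds _)
    show 0 < ⟪gradient V x, g⟫
    rw [← hgdef, real_inner_self_eq_norm_sq]; positivity
  obtain ⟨δ, hδ, hb⟩ := Metric.eventually_nhds_iff_ball.1 hev
  set s0 := δ / (2 * ‖g‖) with hs0
  have hs0pos : 0 < s0 := by positivity
  have hs0g : s0 * ‖g‖ = δ / 2 := by rw [hs0]; field_simp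
  -- strict decrease
  have hdec : ∀ y ∈ ball x (δ / 2), ∀ s ∈ Ioc (0:ℝ) s0, V (y + s • (-g)) < V y := by
    intro y hy s hs
    rw [mem_ball, dist_eq_norm] at hy
    refine aux_ray hV y (-g) (s0 + s0 * ((δ / 2 - ‖y - x‖) / δ)) (fun t ht => ?_) s ⟨hs.1, ?_⟩
    · rw [inner_neg_right, neg_lt_zero]
      apply hb
      rw [mem_ball, dist_eq_norm]
      have : y + t • -g - x = (y - x) - t • g := by module
      rw [this]
      have h1 : ‖t • g‖ < δ / 2 + (δ / 2 - ‖y - x‖) / 2 := by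
        rw [norm_smul, Real.norm_of_nonneg ht.1.le]
        calc t * ‖g‖ < (s0 + s0 * ((δ / 2 - ‖y - x‖) / δ)) * ‖g‖ := by gcongr; exact ht.2
          _ = s0 * ‖g‖ * (1 + (δ / 2 - ‖y - x‖) / δ) := by ring
          _ = _ := by rw [hs0g]; field_simp
      have h2 := norm_sub_le (y - x) (t • g)
      linarith
    · have : 0 < s0 * ((δ / 2 - ‖y - x‖) / δ) := by
        have : 0 < δ / 2 - ‖y - x‖ := by linarith
        positivity
      linarith [hs.2]
  have hxs : V (x + s0 • (-g)) < V x := hdec x (by simp [hδ]) s0 ⟨hs0pos, le_rfl⟩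
  have hev2 : ∀ᶠ z in 𝓝 (x + s0 • (-g)), V z < V x :=
    hV.continuous.continuousAt.eventually (gt_mem_nhds hxs)
  obtain ⟨η', hη', hb2⟩ := Metric.eventually_nhds_iff_ball.1 hev2
  set η := min η' (δ / 2) with hη
  have hηpos : 0 < η := by positivity
  set O := {y | V y < V x} with hO
  set c := x + s0 • (-g)
  refine ⟨ball x η, ball c η ∪ ⋃ y ∈ ball x η ∩ O, segment ℝ y (y + s0 • (-g)),
    isOpen_ball, mem_ball_self hηpos, ?_, ?_, ?_, ?_⟩
  · apply isPreconnected_of_forall c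
    intro z hz
    rcases hz with hz | hz
    · exact ⟨ball c η, subset_union_left, mem_ball_self hηpos, hz, isPreconnected_ball⟩
    · simp only [mem_iUnion] at hz
      obtain ⟨y, hy, hz⟩ := hz
      refine ⟨ball c η ∪ segment ℝ y (y + s0 • (-g)), ?_, Or.inl (mem_ball_self hηpos), Or.inr hz, ?_⟩
      · apply union_subset_union_right
        exact subset_biUnion_of_mem (u := fun y => segment ℝ y (y + s0 • (-g))) hy
      · refine IsPreconnected.union (y + s0 • (-g)) ?_ (right_mem_segment _ _ _) isPreconnected_ball
          (convex_segment _ _).isPreconnected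
        have := hy.1
        rw [mem_ball, dist_eq_norm] at this ⊢
        convert this using 2
        simp only [c]; abel
  · apply union_subset
    · intro z hz
      exact hb2 z (ball_subset_ball (min_le_left _ _) hz)
    · apply iUnion₂_subset
      intro y hy z hz
      rw [segment_eq_image'] at hz
      obtain ⟨θ, hθ, rfl⟩ := hz
      have hyO : V y < V x := hy.2
      rcases hθ.1.eq_or_lt with h0 | h0
      · show V _ < V x
        rw [← h0]; simpa using hyO
      · have := hdec y (ball_subset_ball (min_le_right _ _) hy.1) (θ * s0) ⟨by positivity, by nlinarith [hθ.2]⟩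
        have e : y + θ • (y + s0 • -g - y) = y + (θ * s0) • (-g) := by module
        show V (y + θ • (y + s0 • -g - y)) < V x
        rw [e]; linarith
  · intro y hy
    refine Or.inr ?_
    simp only [mem_iUnion]
    exact ⟨y, hy, left_mem_segment _ _ _⟩
  · rintro y ⟨hy, hyK⟩
    have hyK' : V y ≤ V x := hyK
    have ht : Tendsto (fun s : ℝ => y + s • (-g)) (𝓝[>] 0) (𝓝 y) := by
      have : Continuous (fun s : ℝ => y + s • (-g)) := by fun_prop
      have := (this.tendsto 0).mono_left (nhdsWithin_le_nhds (s := Ioi (0:ℝ)))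
      simpa using this
    refine mem_closure_of_tendsto ht ?_
    filter_upwards [ht.eventually (isOpen_ball.mem_nhds hy), Ioc_mem_nhdsGT hs0pos] with s h1 h2
    refine Or.inr ?_
    simp only [mem_iUnion]
    refine ⟨y + s • (-g), ⟨h1, ?_⟩, left_mem_segment _ _ _⟩
    exact (hdec y (ball_subset_ball (min_le_right _ _) hy) s h2).trans_le hyK'

theorem aux_mp (hd : 2 ≤ d) {V : Euc d → ℝ} (hV : ContDiff ℝ 2 V)
    (hco : Tendsto V (cocompact (Euc d)) atTop) (hV0 : ∀ x, 0 ≤ V x)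
    (hcrit : ∀ x, gradient V x = 0 → IsLocalMin V x ∨ ∃ δ > 0, ∀ y ∈ ball x δ, y ≠ x → V y < V x)
    (hcl : IsClosed (localMinSet V))
    (hopen : ∀ p, IsLocalMin V p → ∀ᶠ q in 𝓝 p, V q ≤ V p → IsLocalMin V q)
    (p0 p1 : Euc d) (h0 : IsLocalMin V p0) (h1 : IsLocalMin V p1) (hlt : V p0 < V p1) : False := by
  set J : Set ℝ := {t | ∃ C : Set (Euc d), IsPreconnected C ∧ C ⊆ {x | V x ≤ t} ∧ p0 ∈ C ∧ p1 ∈ C}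
    with hJ
  have hJne : J.Nonempty := by
    have hsc : IsCompact (segment ℝ p0 p1) := by
      rw [segment_eq_image_lineMap]
      exact isCompact_Icc.image (by fun_prop)
    obtain ⟨t, ht⟩ := (hsc.image hV.continuous).bddAbove
    refine ⟨t, segment ℝ p0 p1, (convex_segment _ _).isPreconnected, ?_, left_mem_segment _ _ _,
      right_mem_segment _ _ _⟩
    intro x hx
    exact ht (mem_image_of_mem _ hx)
  have hJb : BddBelow J := ⟨0, by
    rintro t ⟨C, -, hC, hp, -⟩
    exact (hV0 p0).trans (hC hp)⟩
  set t := sInf J with ht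
  have hup : ∀ s > t, ∃ C : Set (Euc d), IsPreconnected C ∧ C ⊆ {x | V x ≤ s} ∧ p0 ∈ C ∧ p1 ∈ C := by
    intro s hs
    obtain ⟨u, ⟨C, hC1, hC2, hC3⟩, hu⟩ := exists_lt_of_csInf_lt hJne hs
    exact ⟨C, hC1, hC2.trans (fun x (hx : V x ≤ u) => hx.trans hu.le), hC3⟩
  have hsep : ∀ A B : Set (Euc d), IsClosed A → IsClosed B → Disjoint A B →
      {x | V x ≤ t} ⊆ A ∪ B → p0 ∈ A → p1 ∈ B → False := by
    intro A B hA hB hAB hK hp0 hp1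
    obtain ⟨s, hs, h⟩ := aux_sep hV.continuous hco t A B hA hB hAB hK
    obtain ⟨C, hC1, hC2, hC3, hC4⟩ := hup s hs
    exact h C hC1 hC2 p0 hC3 hp0 p1 hC4 hp1
  have hle : ∀ s > t, V p0 ≤ s ∧ V p1 ≤ s := by
    intro s hs
    obtain ⟨C, hC1, hC2, hC3, hC4⟩ := hup s hs
    exact ⟨hC2 hC3, hC2 hC4⟩
  have hp0t : V p0 ≤ t := le_of_forall_gt_imp_ge_of_dense fun s hs => (hle s hs).1
  have hp1t : V p1 ≤ t := le_of_forall_gt_imp_ge_of_dense fun s hs => (hle s hs).2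
  have hKcl : IsClosed {x | V x ≤ t} := isClosed_le hV.continuous continuous_const
  -- p1 strictly below
  have hp1lt : V p1 < t := by
    refine lt_of_le_of_ne hp1t fun he => ?_
    set Sg := localMinSet V ∩ {x | V x = t} with hSg
    have hmn : ∀ p ∈ Sg, ∃ w : Set (Euc d), IsOpen w ∧ p ∈ w ∧ ∀ q ∈ w, V q ≤ t → q ∈ Sg := by
      intro p hp
      have e1 : V p = t := hp.2
      have hp1 : IsLocalMin V p := hp.1
      have := (hopen p hp1).and hp1
      obtain ⟨w, hw1, hw2, hw3⟩ := _root_.eventually_nhds_iff.1 this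
      refine ⟨w, hw2, hw3, fun q hq hqt => ?_⟩
      have := hw1 q hq
      rw [e1] at this
      exact ⟨this.1 hqt, le_antisymm hqt this.2⟩
    choose! w hw using hmn
    refine hsep ({x | V x ≤ t} \ ⋃ p ∈ Sg, w p) Sg (hKcl.sdiff (isOpen_biUnion fun p hp => (hw p hp).1))
      (hcl.inter (isClosed_eq hV.continuous continuous_const)) ?_ ?_ ?_ ⟨h1, he⟩
    · rw [disjoint_left]
      rintro x ⟨hx1, hx2⟩ hx3
      exact hx2 (mem_biUnion hx3 (hw x hx3).2.1)
    · intro x hx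
      by_cases hxw : x ∈ ⋃ p ∈ Sg, w p
      · right
        simp only [mem_iUnion] at hxw
        obtain ⟨p, hp, hxp⟩ := hxw
        exact (hw p hp).2.2 x hxp hx
      · exact Or.inl ⟨hx, hxw⟩
    · refine ⟨hp0t, fun hxw => ?_⟩
      simp only [mem_iUnion] at hxw
      obtain ⟨p, hp, hxp⟩ := hxw
      have : V p0 = t := ((hw p hp).2.2 p0 hxp hp0t).2
      linarith
  have hp0lt : V p0 < t := by linarith
  set O := {x | V x < t} with hO
  have hOo : IsOpen O := isOpen_lt hV.continuous continuous_const
  set O0 := connectedComponentIn O p0 with hO0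
  have hO0o : IsOpen O0 := hOo.connectedComponentIn
  have hO0c : IsPreconnected O0 := isPreconnected_connectedComponentIn
  have hp0O0 : p0 ∈ O0 := mem_connectedComponentIn hp0lt
  have hO0O : O0 ⊆ O := connectedComponentIn_subset _ _
  have hmax : ∀ W : Set (Euc d), IsPreconnected W → W ⊆ O → (W ∩ O0).Nonempty → W ⊆ O0 := by
    rintro W hW hWO ⟨z, hz1, hz2⟩
    have := hW.subset_connectedComponentIn hz1 hWO
    rw [hO0, connectedComponentIn_eq hz2]
    exact this
  -- local structure
  have hloc : ∀ x ∈ closure O0, ∃ B : Set (Euc d), IsOpen B ∧ x ∈ B ∧ B ∩ {y | V y ≤ t} ⊆ closure O0 := by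
    intro x hx
    have hxK : x ∈ {x | V x ≤ t} := closure_minimal (fun y hy => (show V y < t from hO0O hy).le) hKcl hx
    replace hxK : V x ≤ t := hxK
    rcases hxK.lt_or_eq with hxt | hxt
    · obtain ⟨η, hη, hb⟩ := Metric.isOpen_iff.1 hOo x hxt
      refine ⟨ball x η, isOpen_ball, mem_ball_self hη, ?_⟩
      have := hmax (ball x η) isPreconnected_ball hb (by
        have := mem_closure_iff.1 hx (ball x η) isOpen_ball (mem_ball_self hη)
        exact this)
      exact inter_subset_left.trans (this.trans subset_closure)
    · by_cases hg : gradient V x = 0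
      · rcases hcrit x hg with hm | ⟨δ, hδ, hm⟩
        · exfalso
          obtain ⟨w, hw1, hw2, hw3⟩ := _root_.eventually_nhds_iff.1 hm
          obtain ⟨z, hz1, hz2⟩ := mem_closure_iff.1 hx w hw2 hw3
          have h2 := hw1 z hz1
          have h3 : V z < t := hO0O hz2
          linarith
        · refine ⟨ball x δ, isOpen_ball, mem_ball_self hδ, ?_⟩
          have hWO : ball x δ \ {x} ⊆ O := fun y hy => by
            have := hm y hy.1 hy.2
            rw [hxt] at this; exact this
          have := hmax (ball x δ \ {x}) (aux_punctured hd x δ hδ) hWO (by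
            obtain ⟨z, hz1, hz2⟩ := mem_closure_iff.1 hx (ball x δ) isOpen_ball (mem_ball_self hδ)
            refine ⟨z, ⟨hz1, ?_⟩, hz2⟩
            rintro rfl
            have : V z < t := hO0O hz2
            linarith)
          rintro y ⟨hy1, hy2⟩
          by_cases hyx : y = x
          · rw [hyx]; exact hx
          · exact subset_closure (this ⟨hy1, hyx⟩)
      · obtain ⟨B, W, hB, hxB, hW, hWO, hBW, hBK⟩ := aux_regular hV x hg
        rw [hxt] at hWO hBW hBK
        have := hmax W hW hWO (by
          obtain ⟨z, hz1, hz2⟩ := mem_closure_iff.1 hx B hB hxB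
          exact ⟨z, hBW ⟨hz1, hO0O hz2⟩, hz2⟩)
        exact ⟨B, hB, hxB, hBK.trans (closure_mono this)⟩
  choose! B hB using hloc
  have hp1O0 : p1 ∈ O0 := by
    by_contra hp1n
    have hp1c : p1 ∉ closure O0 := by
      intro hc
      obtain ⟨η, hη, hb⟩ := Metric.isOpen_iff.1 hOo p1 hp1lt
      have := hmax (ball p1 η) isPreconnected_ball hb
        (mem_closure_iff.1 hc (ball p1 η) isOpen_ball (mem_ball_self hη))
      exact hp1n (this (mem_ball_self hη))
    refine hsep (closure O0) ({x | V x ≤ t} \ ⋃ x ∈ closure O0, B x) isClosed_closure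
      (hKcl.sdiff (isOpen_biUnion fun x hx => (hB x hx).1)) ?_ ?_ (subset_closure hp0O0) ?_
    · rw [disjoint_left]
      rintro x hx ⟨-, hx2⟩
      exact hx2 (mem_biUnion hx (hB x hx).2.1)
    · intro x hx
      by_cases hxB : x ∈ ⋃ x ∈ closure O0, B x
      · left
        simp only [mem_iUnion] at hxB
        obtain ⟨p, hp, hxp⟩ := hxB
        exact (hB p hp).2.2 ⟨hxp, hx⟩
      · exact Or.inr ⟨hx, hxB⟩
    · refine ⟨hp1t, fun hxB => ?_⟩
      simp only [mem_iUnion] at hxB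
      obtain ⟨p, hp, hxp⟩ := hxB
      exact hp1c ((hB p hp).2.2 ⟨hxp, hp1t⟩)
  -- path
  have hpc : IsPathConnected O0 := (hO0o.isConnected_iff_isPathConnected).1 ⟨⟨p0, hp0O0⟩, hO0c⟩
  obtain ⟨γ, hγ⟩ := hpc.joinedIn p0 hp0O0 p1 hp1O0
  have hrc : IsCompact (range γ) := isCompact_range γ.continuous
  obtain ⟨z, hz, hzmax⟩ := hrc.exists_isMaxOn ⟨_, mem_range_self 0⟩ hV.continuous.continuousOn
  obtain ⟨s, rfl⟩ := hz
  have hlt' : V (γ s) < t := hO0O (hγ s)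
  have : V (γ s) ∈ J := ⟨range γ, isPreconnected_range γ.continuous, fun x hx => hzmax hx,
    ⟨0, γ.source⟩, ⟨1, γ.target⟩⟩
  exact absurd (csInf_le hJb this) (not_le.2 hlt')


theorem aux_S_sub {V : Euc d → ℝ} {ν : ℝ} {𝒩 : Set (Euc d) → Set (Euc d)}
    (h1 : Assumption1 V ν 𝒩) : localMinSet V ⊆ NSet V 𝒩 := fun x hx =>
  mem_biUnion hx ((h1.2 x hx).2.1 (mem_connectedComponentIn hx))

theorem aux_N_open {V : Euc d → ℝ} {ν : ℝ} {𝒩 : Set (Euc d) → Set (Euc d)}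
    (h1 : Assumption1 V ν 𝒩) : IsOpen (NSet V 𝒩) :=
  isOpen_biUnion fun x hx => (h1.2 x hx).1

theorem aux_grad_zero {V : Euc d → ℝ} {x : Euc d} (hx : IsLocalMin V x) : gradient V x = 0 := by
  rw [gradient, hx.fderiv_eq_zero]; simp

theorem aux_inf_le {V : Euc d → ℝ} (hmin0 : ∀ x, 0 ≤ V x) (T : Set (Euc d)) {y : Euc d} (hy : y ∈ T) :
    sInf (V '' T) ≤ V y :=
  csInf_le ⟨0, by rintro _ ⟨z, -, rfl⟩; exact hmin0 z⟩ (mem_image_of_mem _ hy)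

theorem aux_crit_val {V : Euc d → ℝ} {ν : ℝ} {𝒩 : Set (Euc d) → Set (Euc d)}
    (h1 : Assumption1 V ν 𝒩) (hmin0 : ∀ x, 0 ≤ V x) {p y : Euc d} (hp : p ∈ localMinSet V)
    (hy : y ∈ 𝒩 (connectedComponentIn (localMinSet V) p)) (hg : gradient V y = 0) :
    V y = sInf (V '' 𝒩 (connectedComponentIn (localMinSet V) p)) := by
  apply le_antisymm _ (aux_inf_le hmin0 _ hy)
  have := (h1.2 p hp).2.2.2 y hy
  rw [hg] at this
  simp only [norm_zero, ne_eq, OfNat.ofNat_ne_zero, not_false_eq_true, zero_pow] at this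
  nlinarith [h1.1]

theorem aux_val_min {V : Euc d → ℝ} {ν : ℝ} {𝒩 : Set (Euc d) → Set (Euc d)}
    (h1 : Assumption1 V ν 𝒩) (hmin0 : ∀ x, 0 ≤ V x) {p y : Euc d} (hp : p ∈ localMinSet V)
    (hy : y ∈ 𝒩 (connectedComponentIn (localMinSet V) p))
    (hv : V y ≤ sInf (V '' 𝒩 (connectedComponentIn (localMinSet V) p))) : IsLocalMin V y := by
  filter_upwards [(h1.2 p hp).1.mem_nhds hy] with z hz
  exact hv.trans (aux_inf_le hmin0 _ hz)

theorem aux_crit_min {V : Euc d → ℝ} {ν : ℝ} {𝒩 : Set (Euc d) → Set (Euc d)}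
    (h1 : Assumption1 V ν 𝒩) (hmin0 : ∀ x, 0 ≤ V x) {y : Euc d} (hy : y ∈ NSet V 𝒩)
    (hg : gradient V y = 0) : IsLocalMin V y := by
  simp only [NSet, mem_iUnion] at hy
  obtain ⟨p, hp, hy⟩ := hy
  exact aux_val_min h1 hmin0 hp hy (aux_crit_val h1 hmin0 hp hy hg).le

theorem aux_mem_own {V : Euc d → ℝ} {ν : ℝ} {𝒩 : Set (Euc d) → Set (Euc d)}
    (h1 : Assumption1 V ν 𝒩) {p : Euc d} (hp : p ∈ localMinSet V) :
    p ∈ 𝒩 (connectedComponentIn (localMinSet V) p) :=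
  (h1.2 p hp).2.1 (mem_connectedComponentIn hp)

theorem aux_hopen {V : Euc d → ℝ} {ν : ℝ} {𝒩 : Set (Euc d) → Set (Euc d)}
    (h1 : Assumption1 V ν 𝒩) (hmin0 : ∀ x, 0 ≤ V x) (p : Euc d) (hp : IsLocalMin V p) :
    ∀ᶠ q in 𝓝 p, V q ≤ V p → IsLocalMin V q := by
  filter_upwards [(h1.2 p hp).1.mem_nhds (aux_mem_own h1 hp)] with q hq hqp
  refine aux_val_min h1 hmin0 hp hq (hqp.trans ?_)
  exact (aux_crit_val h1 hmin0 hp (aux_mem_own h1 hp) (aux_grad_zero hp)).le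

theorem aux_locconst {V : Euc d → ℝ} {ν : ℝ} {𝒩 : Set (Euc d) → Set (Euc d)}
    (h1 : Assumption1 V ν 𝒩) (hmin0 : ∀ x, 0 ≤ V x) (p : Euc d) (hp : IsLocalMin V p) :
    ∀ᶠ q in 𝓝 p, IsLocalMin V q → V q = V p := by
  filter_upwards [(h1.2 p hp).1.mem_nhds (aux_mem_own h1 hp)] with q hq hqp
  rw [aux_crit_val h1 hmin0 hp (aux_mem_own h1 hp) (aux_grad_zero hp),
    aux_crit_val h1 hmin0 hp hq (aux_grad_zero hqp)]

theorem aux_tube {V : Euc d → ℝ} {ν : ℝ} {𝒩 : Set (Euc d) → Set (Euc d)}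
    (h1 : Assumption1 V ν 𝒩) {δ₀ : ℝ}
    (hδ : ∀ x ∈ frontier (NSet V 𝒩), δ₀ ≤ infDist x (localMinSet V))
    {q : Euc d} (hq : q ∈ localMinSet V) : ball q δ₀ ⊆ NSet V 𝒩 := by
  rcases le_or_gt δ₀ 0 with h0 | h0
  · rw [ball_eq_empty.2 h0]; exact empty_subset _
  have hN := aux_N_open h1
  have hc : IsPreconnected (ball q δ₀) := isPreconnected_ball
  refine hc.subset_left_of_subset_union hN (isClosed_closure (s := NSet V 𝒩)).isOpen_compl ?_ ?_ ?_
  · exact disjoint_compl_right.mono_left subset_closure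
  · intro x hx
    by_cases hxN : x ∈ NSet V 𝒩
    · exact Or.inl hxN
    · right
      intro hxc
      have : x ∈ frontier (NSet V 𝒩) := by
        rw [hN.frontier_eq]; exact ⟨hxc, hxN⟩
      have h2 := hδ x this
      have h3 := infDist_le_dist_of_mem (x := x) hq
      have h4 : dist x q < δ₀ := hx
      linarith
  · exact ⟨q, mem_ball_self h0, aux_S_sub h1 hq⟩

theorem aux_closed {V : Euc d → ℝ} (hV : ContDiff ℝ 2 V) {ν : ℝ} {𝒩 : Set (Euc d) → Set (Euc d)}
    (h1 : Assumption1 V ν 𝒩) (hmin0 : ∀ x, 0 ≤ V x) {δ₀ : ℝ} (hδ₀ : 0 < δ₀)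
    (hδ : ∀ x ∈ frontier (NSet V 𝒩), δ₀ ≤ infDist x (localMinSet V)) :
    IsClosed (localMinSet V) := by
  refine isClosed_of_closure_subset fun x hx => ?_
  obtain ⟨q, hq, hxq⟩ := Metric.mem_closure_iff.1 hx δ₀ hδ₀
  have hxN : x ∈ NSet V 𝒩 := aux_tube h1 hδ hq hxq
  have hg : gradient V x = 0 := by
    have hcl : IsClosed {y | gradient V y = 0} :=
      isClosed_eq (aux_grad0 (hV.of_le (by norm_num))) continuous_const
    exact closure_minimal (fun y (hy : IsLocalMin V y) => aux_grad_zero hy) hcl hx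
  exact aux_crit_min h1 hmin0 hxN hg

theorem aux_PL0 {V : Euc d → ℝ} {ν : ℝ} {𝒩 : Set (Euc d) → Set (Euc d)}
    (h1 : Assumption1 V ν 𝒩) (hmin0 : ∀ x, 0 ≤ V x) (hS0 : ∀ p ∈ localMinSet V, V p = 0)
    {y : Euc d} (hy : y ∈ NSet V 𝒩) : ν * V y ≤ ‖gradient V y‖ ^ 2 := by
  simp only [NSet, mem_iUnion] at hy
  obtain ⟨p, hp, hy⟩ := hy
  have := (h1.2 p hp).2.2.2 y hy
  rw [← aux_crit_val h1 hmin0 hp (aux_mem_own h1 hp) (aux_grad_zero hp), hS0 p hp, sub_zero] at this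
  exact this

theorem aux_nu_le {V : Euc d → ℝ} (hV : ContDiff ℝ 2 V) {S N : Set (Euc d)} {ν : ℝ}
    (hS : IsClosed S) (hne : S.Nonempty) (hnu : S ≠ univ) (hN : IsOpen N) (hSN : S ⊆ N)
    (hS0 : ∀ p ∈ S, gradient V p = 0)
    (heb : ∀ x ∈ N, ν * infDist x S ≤ ‖gradient V x‖) :
    ∃ p ∈ S, ν ≤ ‖fderiv ℝ (gradient V) p‖ := by
  have hfr : (frontier S).Nonempty := nonempty_frontier_iff.2 ⟨hne, hnu⟩
  obtain ⟨p, hp⟩ := hfr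
  have hpS : p ∈ S := hS.frontier_subset hp
  refine ⟨p, hpS, ?_⟩
  by_contra hc
  push Not at hc
  obtain ⟨η, hη1, hη2⟩ := exists_between hc
  have hη0 : 0 ≤ η := (norm_nonneg _).trans hη1.le
  have hg1 := aux_grad1 hV
  have hcont : Continuous (fun z => ‖fderiv ℝ (gradient V) z‖) :=
    (hg1.continuous_fderiv one_ne_zero).norm
  have hev : ∀ᶠ z in 𝓝 p, ‖fderiv ℝ (gradient V) z‖ < η ∧ z ∈ N :=
    (hcont.continuousAt.eventually (gt_mem_nhds hη1)).and (hN.mem_nhds (hSN hpS))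
  obtain ⟨δ, hδ, hb⟩ := Metric.eventually_nhds_iff_ball.1 hev
  have hpc : p ∈ closure Sᶜ := by
    rw [frontier_eq_closure_inter_closure] at hp; exact hp.2
  obtain ⟨x, hx, hxp⟩ := Metric.mem_closure_iff.1 hpc (δ / 2) (by positivity)
  obtain ⟨q, hq, hxq⟩ := hS.exists_infDist_eq_dist hne x
  have h1 : dist x q ≤ dist x p := by rw [← hxq]; exact infDist_le_dist_of_mem hpS
  have hxb : x ∈ ball p δ := by rw [mem_ball, dist_comm]; linarith
  have hqb : q ∈ ball p δ := by
    rw [mem_ball]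
    have := dist_triangle q x p
    rw [dist_comm q x] at this
    rw [dist_comm p x] at hxp
    linarith
  have h2 : ‖gradient V x - gradient V q‖ ≤ η * ‖x - q‖ :=
    (convex_ball p δ).norm_image_sub_le_of_norm_fderiv_le
      (fun z _ => (hg1.differentiable one_ne_zero).differentiableAt)
      (fun z hz => (hb z hz).1.le) hqb hxb
  rw [hS0 q hq, sub_zero, ← dist_eq_norm] at h2
  have h3 := heb x (hb x hxb).2
  rw [hxq] at h3
  have h4 : 0 < dist x q := by
    rw [dist_pos]; rintro rfl; exact hx hq
  nlinarith

theorem aux_Vlow {V : Euc d → ℝ} (hV : ContDiff ℝ 2 V)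
    (hco : Tendsto V (cocompact (Euc d)) atTop) (hmin0 : ∀ x, 0 ≤ V x)
    {S : Set (Euc d)} (hne : S.Nonempty) {ν r : ℝ} (hν : 0 < ν)
    (heb : ∀ x, infDist x S < r → ν * infDist x S ≤ ‖gradient V x‖)
    (x0 : Euc d) (hx0 : infDist x0 S < 2 * r / 3) : ν * infDist x0 S ^ 2 / 8 ≤ V x0 := by
  set s := infDist x0 S with hs
  rcases (infDist_nonneg (x := x0) (s := S)).eq_or_lt with h0 | hspos
  · rw [hs, ← h0]; simpa using hmin0 x0
  by_contra hc
  push Not at hc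
  set k := ν / 2 with hk
  set F : Euc d → ℝ := fun x => V x + k * ‖x - x0‖ ^ 2 with hF
  have hFc : Continuous F := by
    have := hV.continuous
    fun_prop
  have hFt : Tendsto F (cocompact (Euc d)) atTop := by
    refine tendsto_atTop_mono (fun x => ?_) hco
    simp only [F]
    have : 0 ≤ k * ‖x - x0‖ ^ 2 := by positivity
    linarith
  obtain ⟨x1, hx1⟩ := hFc.exists_forall_le hFt
  have hd1 : HasFDerivAt V (fderiv ℝ V x1) x1 :=
    (hV.differentiable two_ne_zero).differentiableAt.hasFDerivAt
  have hd2 : HasFDerivAt (fun x : Euc d => ‖x - x0‖ ^ 2) (2 • (innerSL ℝ (x1 - x0))) x1 := by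
    have := ((hasFDerivAt_id x1).sub_const x0).norm_sq
    simpa using this
  have hd3 : HasFDerivAt F (fderiv ℝ V x1 + k • (2 • (innerSL ℝ (x1 - x0)))) x1 :=
    hd1.add (hd2.const_mul k)
  have hz := (show IsLocalMin F x1 from Eventually.of_forall hx1).hasFDerivAt_eq_zero hd3
  have hgr : gradient V x1 = - (ν • (x1 - x0)) := by
    apply ext_inner_right ℝ
    intro w
    have := congrArg (fun T => T w) hz
    simp only [ContinuousLinearMap.add_apply, ContinuousLinearMap.smul_apply, innerSL_apply_apply,
      ContinuousLinearMap.zero_apply] at this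
    rw [inner_gradient_left, inner_neg_left, inner_smul_left]
    simp [hk] at this ⊢
    linarith
  have h1 := hx1 x0
  simp only [F, sub_self, norm_zero] at h1
  have h2 := hmin0 x1
  have h3 : ‖x1 - x0‖ ^ 2 < (s / 2) ^ 2 := by
    rw [hk] at h1
    have : ν / 2 * ‖x1 - x0‖ ^ 2 < ν / 2 * (s / 2) ^ 2 := by nlinarith
    exact lt_of_mul_lt_mul_left this (by positivity)
  have h4 : ‖x1 - x0‖ < s / 2 := lt_of_pow_lt_pow_left₀ 2 (by positivity) h3
  have h5 := infDist_le_infDist_add_dist (s := S) (x := x1) (y := x0)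
  have h6 := infDist_le_infDist_add_dist (s := S) (x := x0) (y := x1)
  rw [dist_comm, dist_eq_norm] at h6
  rw [dist_eq_norm] at h5
  have h7 := heb x1 (by linarith)
  rw [hgr, norm_neg, norm_smul, Real.norm_of_nonneg hν.le] at h7
  have h8 := le_of_mul_le_mul_left h7 hν
  linarith

theorem aux_Vup {V : Euc d → ℝ} (hV : ContDiff ℝ 2 V) {N : Set (Euc d)} {q : Euc d} {r L : ℝ}
    (hr : 0 < r) (hL0 : 0 ≤ L) (hq : gradient V q = 0) (hN : ball q r ⊆ N)
    (hL : ∀ x ∈ N, ‖fderiv ℝ (gradient V) x‖ ≤ L) :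
    ∀ x ∈ closedBall q r, V x ≤ V q + L * r ^ 2 := by
  have hg1 := aux_grad1 hV
  have h1 : ∀ x ∈ ball q r, ‖gradient V x‖ ≤ L * r := by
    intro x hx
    have := (convex_ball q r).norm_image_sub_le_of_norm_fderiv_le
      (fun z _ => (hg1.differentiable one_ne_zero).differentiableAt)
      (fun z hz => hL z (hN hz)) (mem_ball_self hr) hx
    rw [hq, sub_zero] at this
    rw [mem_ball, dist_eq_norm] at hx
    exact this.trans (by gcongr)
  have h2 : ∀ x ∈ ball q r, V x ≤ V q + L * r ^ 2 := by
    intro x hx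
    have := (convex_ball q r).norm_image_sub_le_of_norm_fderiv_le (f := V) (𝕜 := ℝ) (C := L * r)
      (fun z _ => (hV.differentiable two_ne_zero).differentiableAt)
      (fun z hz => ?_) (mem_ball_self hr) hx
    · rw [mem_ball, dist_eq_norm] at hx
      have h3 : L * r * ‖x - q‖ ≤ L * r * r := by gcongr
      have h4 := (le_abs_self _).trans this
      nlinarith
    · rw [← toDual_gradient, LinearIsometryEquiv.norm_map]; exact h1 z hz
  intro x hx
  rw [← closure_ball q hr.ne'] at hx
  exact closure_minimal h2 (isClosed_le hV.continuous continuous_const) hx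

theorem aux_eb_closed {V : Euc d → ℝ} (hV : ContDiff ℝ 2 V) {S N : Set (Euc d)} {q : Euc d} {r ν : ℝ}
    (hr : 0 < r) (hN : ball q r ⊆ N)
    (heb : ∀ x ∈ N, ν * infDist x S ≤ ‖gradient V x‖) :
    ∀ x ∈ closedBall q r, ν * infDist x S ≤ ‖gradient V x‖ := by
  intro x hx
  rw [← closure_ball q hr.ne'] at hx
  exact closure_minimal (fun y hy => heb y (hN hy))
    (isClosed_le (continuous_const.mul (continuous_infDist_pt S)) 
      (aux_grad1 hV).continuous.norm) hx


theorem aux_gmul {f g : Euc d → ℝ} {x : Euc d} (hf : DifferentiableAt ℝ f x)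
    (hg : DifferentiableAt ℝ g x) :
    gradient (fun y => f y * g y) x = f x • gradient g x + g x • gradient f x := by
  rw [gradient, fderiv_fun_mul hf hg]
  simp [gradient]

theorem aux_gcomp {φ : ℝ → ℝ} {f : Euc d → ℝ} {x : Euc d} {φ' : ℝ} (hφ : HasDerivAt φ φ' (f x))
    (hf : DifferentiableAt ℝ f x) :
    gradient (fun y => φ (f y)) x = φ' • gradient f x := by
  have := (hφ.comp_hasFDerivAt x hf.hasFDerivAt).fderiv
  have h2 : fderiv ℝ (fun y => φ (f y)) x = φ' • fderiv ℝ f x := this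
  rw [gradient, h2]
  simp [gradient]

theorem aux_ibp1 {u w : Euc d → ℝ} (hu : ContDiff ℝ 1 u) (hc : HasCompactSupport u)
    (hw : ContDiff ℝ 1 w) (v : Euc d) :
    ∫ x, ⟪gradient u x, v⟫ * w x = - ∫ x, u x * fderiv ℝ w x v := by
  have hgu : ∀ x, ⟪gradient u x, v⟫ = fderiv ℝ u x v := fun x => inner_gradient_left
  have hcu : Continuous (fun x => fderiv ℝ u x v) :=
    (hu.continuous_fderiv one_ne_zero).clm_apply continuous_const
  have hcw : Continuous (fun x => fderiv ℝ w x v) :=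
    (hw.continuous_fderiv one_ne_zero).clm_apply continuous_const
  have hcs : HasCompactSupport (fun x => fderiv ℝ u x v) := hc.fderiv_apply ℝ v
  have := integral_mul_fderiv_eq_neg_fderiv_mul_of_integrable (μ := volume) (f := u) (g := w) (v := v)
    ((hcu.mul hw.continuous).integrable_of_hasCompactSupport hcs.mul_right)
    ((hu.continuous.mul hcw).integrable_of_hasCompactSupport hc.mul_right)
    ((hu.continuous.mul hw.continuous).integrable_of_hasCompactSupport hc.mul_right)
    (fun x _ => (hu.differentiable one_ne_zero).differentiableAt)
    (fun x _ => (hw.differentiable one_ne_zero).differentiableAt)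
  rw [this, neg_neg]
  simp_rw [hgu]

theorem aux_grad_supp {u : Euc d → ℝ} (hc : HasCompactSupport u) :
    HasCompactSupport (gradient u) := by
  have h := hc.fderiv (𝕜 := ℝ)
  exact h.comp_left (g := (InnerProductSpace.toDual ℝ (Euc d)).symm) (map_zero _)

theorem aux_lap_cont {V : Euc d → ℝ} (hV : ContDiff ℝ 2 V) : Continuous (lap V) := by
  unfold lap hessQ
  have := (aux_grad1 hV).continuous_fderiv one_ne_zero
  fun_prop

theorem aux_ibp2 {V : Euc d → ℝ} (hV : ContDiff ℝ 2 V) {u : Euc d → ℝ} (hu : ContDiff ℝ 1 u)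
    (hc : HasCompactSupport u) :
    ∫ x, ⟪gradient u x, gradient V x⟫ = - ∫ x, u x * lap V x := by
  have hg1 := aux_grad1 hV
  have hgu := aux_grad0 hu
  set b := EuclideanSpace.basisFun (Fin d) ℝ with hb
  have hcs := aux_grad_supp hc
  have e1 : ∀ x, ⟪gradient u x, gradient V x⟫ = ∑ i, ⟪gradient u x, b i⟫ * ⟪b i, gradient V x⟫ := by
    intro x
    rw [b.sum_inner_mul_inner]
  have hd := hg1.continuous_fderiv one_ne_zero
  simp_rw [e1]
  rw [integral_finsetSum]
  · simp only [lap, Finset.mul_sum]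
    rw [integral_finsetSum, ← Finset.sum_neg_distrib]
    · refine Finset.sum_congr rfl fun i _ => ?_
      rw [aux_ibp1 hu hc (w := fun x => ⟪b i, gradient V x⟫) (contDiff_const.inner ℝ hg1) (b i)]
      congr 1
      refine integral_congr_ae (Eventually.of_forall fun x => ?_)
      simp only [hessQ]
      congr 1
      rw [fderiv_inner_apply ℝ (by fun_prop) (hg1.differentiable one_ne_zero).differentiableAt]
      rw [real_inner_comm]
      simp [hb]
    · intro i _
      unfold hessQ
      refine Continuous.integrable_of_hasCompactSupport ?_ hc.mul_right
      have := hu.continuous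
      fun_prop
  · intro i _
    refine Continuous.integrable_of_hasCompactSupport (by have := hg1.continuous; fun_prop) ?_
    exact HasCompactSupport.mul_right (hcs.comp_left (g := fun z => ⟪z, b i⟫) (by simp))

theorem aux_lyap {V : Euc d → ℝ} (hV : ContDiff ℝ 2 V) {ε : ℝ} (hε : 0 < ε) {h : Euc d → ℝ}
    (hh : ContDiff ℝ 1 h) (hc : HasCompactSupport h) :
    ∫ x, h x ^ 2 * (‖gradient V x‖ ^ 2 / (4 * ε ^ 2) - lap V x / (2 * ε)) * exp (-V x / ε)
      ≤ ∫ x, ‖gradient h x‖ ^ 2 * exp (-V x / ε) := by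
  have hV1 : ContDiff ℝ 1 V := hV.of_le (by norm_num)
  have hVd : Differentiable ℝ V := hV1.differentiable one_ne_zero
  have hhd : Differentiable ℝ h := hh.differentiable one_ne_zero
  have hgV := aux_grad0 hV1
  have hgh := aux_grad0 hh
  have hl := aux_lap_cont hV
  have hVc := hV.continuous
  have hhc := hh.continuous
  set w : Euc d → ℝ := fun x => exp (-V x / ε) with hw
  have hwC : ContDiff ℝ 1 w := by
    rw [hw]; exact (hV1.neg.div_const ε).exp
  have hwc := hwC.continuous
  have hwd : Differentiable ℝ w := hwC.differentiable one_ne_zero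
  have hgw : ∀ x, gradient w x = (-(w x) / ε) • gradient V x := by
    intro x
    have h1 : HasDerivAt (fun t : ℝ => exp (-t / ε)) (-(w x) / ε) (V x) := by
      have := (((hasDerivAt_id (V x)).neg).div_const ε).exp
      refine this.congr_deriv ?_
      simp [hw]; ring
    exact aux_gcomp h1 (hVd x)
  set u : Euc d → ℝ := fun x => (h x * h x) * w x with hu
  have huC : ContDiff ℝ 1 u := (hh.mul hh).mul hwC
  have huc : HasCompactSupport u := (hc.mul_right (f' := h)).mul_right
  have hgu : ∀ x, gradient u x = (2 * h x * w x) • gradient h x - (h x ^ 2 * w x / ε) • gradient V x := by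
    intro x
    rw [hu, aux_gmul (f := fun y => h y * h y) ((hhd x).mul (hhd x)) (hwd x), aux_gmul (hhd x) (hhd x), hgw]
    module
  have key := aux_ibp2 hV huC huc
  have hch : HasCompactSupport (gradient h) := aux_grad_supp hc
  have i1 : Integrable (fun x => ⟪gradient u x, gradient V x⟫) := by
    refine Continuous.integrable_of_hasCompactSupport ?_ ?_
    · have := aux_grad0 huC; fun_prop
    · exact (aux_grad_supp huc).mono (fun x hx => by
        simp only [Function.mem_support] at hx ⊢; intro h0; apply hx; rw [h0]; simp)
  have i2 : Integrable (fun x => u x * lap V x) :=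
    (huC.continuous.mul hl).integrable_of_hasCompactSupport huc.mul_right
  have i3 : Integrable (fun x => ‖gradient h x‖ ^ 2 * w x) := by
    refine Continuous.integrable_of_hasCompactSupport (by fun_prop) ?_
    exact HasCompactSupport.mul_right (hch.comp_left (g := fun z => ‖z‖ ^ 2) (by simp))
  have i4 : Integrable (fun x => u x * (‖gradient V x‖ ^ 2 / (4 * ε ^ 2))) :=
    (huC.continuous.mul (by fun_prop)).integrable_of_hasCompactSupport huc.mul_right
  have hpt : ∀ x, u x * (‖gradient V x‖ ^ 2 / (4 * ε ^ 2)) + (1 / (2 * ε)) * ⟪gradient u x, gradient V x⟫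
      ≤ ‖gradient h x‖ ^ 2 * w x := by
    intro x
    have hw0 : 0 < w x := exp_pos _
    have h0 : 0 ≤ ‖gradient h x - (h x / (2 * ε)) • gradient V x‖ ^ 2 * w x := by positivity
    rw [norm_sub_sq_real, norm_smul, inner_smul_right, mul_pow, Real.norm_eq_abs, sq_abs] at h0
    rw [hgu, inner_sub_left, inner_smul_left, inner_smul_left, real_inner_self_eq_norm_sq]
    simp only [conj_trivial, hu]
    have : ‖gradient h x‖ ^ 2 * w x - (h x * h x * w x * (‖gradient V x‖ ^ 2 / (4 * ε ^ 2)) +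
      1 / (2 * ε) * (2 * h x * w x * ⟪gradient h x, gradient V x⟫ - h x ^ 2 * w x / ε * ‖gradient V x‖ ^ 2))
      = (‖gradient h x‖ ^ 2 - 2 * (h x / (2 * ε) * ⟪gradient h x, gradient V x⟫) + (h x / (2 * ε)) ^ 2 * ‖gradient V x‖ ^ 2) * w x := by
      field_simp
      ring
    linarith
  have := integral_mono (i4.add (i1.const_mul (1 / (2 * ε)))) i3 hpt
  simp only [Pi.add_apply] at this
  rw [integral_add i4 (i1.const_mul _), integral_const_mul, key] at this
  have e : ∫ x, h x ^ 2 * (‖gradient V x‖ ^ 2 / (4 * ε ^ 2) - lap V x / (2 * ε)) * w x =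
      ∫ x, u x * (‖gradient V x‖ ^ 2 / (4 * ε ^ 2)) + (-(1 / (2 * ε))) * (u x * lap V x) := by
    refine integral_congr_ae (Eventually.of_forall fun x => ?_)
    simp only [hu]; ring
  rw [e, integral_add i4 (i2.const_mul _), integral_const_mul]
  linarith

theorem aux_gscale {f : Euc d → ℝ} (hf : Differentiable ℝ f) (c : ℝ) (x : Euc d) :
    gradient (fun y => f (c • y)) x = c • gradient f (c • x) := by
  have h1 : HasFDerivAt (fun y : Euc d => c • y) (c • ContinuousLinearMap.id ℝ (Euc d)) x :=
    (hasFDerivAt_id x).const_smul c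
  have h2 := ((hf (c • x)).hasFDerivAt.comp x h1).fderiv
  have h3 : fderiv ℝ (fun y => f (c • y)) x = c • fderiv ℝ f (c • x) := by
    refine h2.trans ?_
    ext v; simp
  rw [gradient, h3]
  simp [gradient]

theorem aux_cutoff : ∃ (χ : ℕ → Euc d → ℝ) (K : ℝ), (∀ n, ContDiff ℝ 1 (χ n)) ∧
    (∀ n, HasCompactSupport (χ n)) ∧ (∀ n x, 0 ≤ χ n x ∧ χ n x ≤ 1) ∧
    (∀ n x, ‖gradient (χ n) x‖ ≤ K) ∧ (∀ x, ∀ᶠ n in atTop, ∀ᶠ y in 𝓝 x, χ n y = 1) := by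
  let B : ContDiffBump (0 : Euc d) := ⟨1, 2, one_pos, one_lt_two⟩
  have hB : ContDiff ℝ 1 (B : Euc d → ℝ) := B.contDiff
  have hBc : HasCompactSupport (B : Euc d → ℝ) := B.hasCompactSupport
  obtain ⟨K, hK⟩ := (aux_grad_supp hBc).exists_bound_of_continuous (aux_grad0 hB)
  have hc : ∀ n : ℕ, ((n : ℝ) + 1)⁻¹ ≠ 0 := fun n => by positivity
  refine ⟨fun n x => B (((n : ℝ) + 1)⁻¹ • x), K, fun n => ?_, fun n => ?_, fun n x => ⟨B.nonneg, B.le_one⟩,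
    fun n x => ?_, fun x => ?_⟩
  · exact hB.comp (contDiff_const_smul _)
  · exact hBc.comp_homeomorph (Homeomorph.smulOfNeZero _ (hc n))
  · rw [aux_gscale (hB.differentiable one_ne_zero), norm_smul, norm_inv]
    have h1 : (‖(n : ℝ) + 1‖)⁻¹ ≤ 1 := by
      rw [Real.norm_of_nonneg (by positivity)]
      exact inv_le_one_of_one_le₀ (by linarith [n.cast_nonneg (α := ℝ)])
    calc _ ≤ 1 * K := by
          gcongr
          exact hK _
      _ = K := one_mul _
  · obtain ⟨m, hm⟩ := exists_nat_gt ‖x‖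
    filter_upwards [eventually_ge_atTop m] with n hn
    have : ∀ᶠ y in 𝓝 x, ‖y‖ < m := (continuous_norm.tendsto x).eventually (gt_mem_nhds hm)
    filter_upwards [this] with y hy
    apply B.one_of_mem_closedBall
    rw [mem_closedBall_zero_iff, norm_smul, norm_inv, Real.norm_of_nonneg (by positivity)]
    have : (m : ℝ) ≤ n := by exact_mod_cast hn
    rw [inv_mul_le_iff₀ (by positivity)]
    show ‖y‖ ≤ (n + 1) * 1
    linarith

theorem aux_lyap_ext {V : Euc d → ℝ} (hV : ContDiff ℝ 2 V) {ε : ℝ} (hε : 0 < ε)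
    {U : Set (Euc d)} (hU : MeasurableSet U) {θ b : ℝ}
    (hΨ1 : ∀ x ∉ U, θ ≤ ‖gradient V x‖ ^ 2 / (4 * ε ^ 2) - lap V x / (2 * ε))
    (hΨ2 : ∀ x, θ - b ≤ ‖gradient V x‖ ^ 2 / (4 * ε ^ 2) - lap V x / (2 * ε))
    {h : Euc d → ℝ} (hh : ContDiff ℝ 1 h)
    (hi1 : Integrable fun x => h x ^ 2 * exp (-V x / ε))
    (hi2 : Integrable fun x => ‖gradient h x‖ ^ 2 * exp (-V x / ε)) :
    θ * ∫ x, h x ^ 2 * exp (-V x / ε) ≤ (∫ x, ‖gradient h x‖ ^ 2 * exp (-V x / ε)) +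
      b * ∫ x in U, h x ^ 2 * exp (-V x / ε) := by
  obtain ⟨χ, K, hχ1, hχ2, hχ3, hχ4, hχ5⟩ := aux_cutoff (d := d)
  have hVc := hV.continuous
  have hgV := aux_grad0 (hV.of_le (by norm_num) : ContDiff ℝ 1 V)
  have hl := aux_lap_cont hV
  have hhc := hh.continuous
  have hgh := aux_grad0 hh
  have hhd := hh.differentiable one_ne_zero
  set w : Euc d → ℝ := fun x => exp (-V x / ε) with hw
  have hwc : Continuous w := by rw [hw]; fun_prop
  have hw0 : ∀ x, 0 < w x := fun x => exp_pos _
  have hm : ∀ n, ContDiff ℝ 1 (fun x => χ n x * h x) := fun n => (hχ1 n).mul hh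
  have hmc : ∀ n, HasCompactSupport (fun x => χ n x * h x) := fun n => (hχ2 n).mul_right
  have hsq1 : ∀ n x, χ n x ^ 2 ≤ 1 := fun n x => pow_le_one₀ (hχ3 n x).1 (hχ3 n x).2
  have step : ∀ n, θ * (∫ x, (χ n x * h x) ^ 2 * w x) ≤
      (∫ x, ‖gradient (fun x => χ n x * h x) x‖ ^ 2 * w x) + b * ∫ x in U, (χ n x * h x) ^ 2 * w x := by
    intro n
    refine le_trans ?_ (add_le_add_left (aux_lyap hV hε (hm n) (hmc n)) _)
    have hχc := (hχ1 n).continuous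
    have i1 : Integrable (fun x => (χ n x * h x) ^ 2 * w x) := by
      refine Continuous.integrable_of_hasCompactSupport (by fun_prop) ?_
      simp_rw [pow_two]
      exact ((hmc n).mul_right).mul_right
    have i2 : Integrable (fun x => (χ n x * h x) ^ 2 * (‖gradient V x‖ ^ 2 / (4 * ε ^ 2) - lap V x / (2 * ε)) * w x) := by
      refine Continuous.integrable_of_hasCompactSupport (by fun_prop) ?_
      simp_rw [pow_two (χ n _ * h _)]
      exact (((hmc n).mul_right).mul_right).mul_right
    rw [← integral_const_mul, ← integral_indicator hU, ← integral_const_mul, ← integral_add i2]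
    · refine integral_mono (i1.const_mul _) (i2.add ((i1.indicator hU).const_mul b)) fun x => ?_
      have hq : 0 ≤ (χ n x * h x) ^ 2 * w x := mul_nonneg (sq_nonneg _) (hw0 x).le
      simp only [Pi.add_apply]
      by_cases hx : x ∈ U
      · rw [indicator_of_mem hx]
        have := mul_le_mul_of_nonneg_right (hΨ2 x) hq
        nlinarith
      · rw [indicator_of_notMem hx]
        have := mul_le_mul_of_nonneg_right (hΨ1 x hx) hq
        nlinarith
    · exact (i1.indicator hU).const_mul b
  have ptw : ∀ x, ∀ᶠ n in atTop, χ n x = 1 := fun x => (hχ5 x).mono fun n hn => hn.self_of_nhds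
  have lim1 : ∀ μ : Measure (Euc d), Integrable (fun x => h x ^ 2 * w x) μ →
      Tendsto (fun n => ∫ x, (χ n x * h x) ^ 2 * w x ∂μ) atTop (𝓝 (∫ x, h x ^ 2 * w x ∂μ)) := by
    intro μ hμ
    refine tendsto_integral_of_dominated_convergence (fun x => h x ^ 2 * w x) (fun n => ?_) hμ
      (fun n => Eventually.of_forall fun x => ?_) (Eventually.of_forall fun x => ?_)
    · have := (hχ1 n).continuous
      exact Continuous.aestronglyMeasurable (by fun_prop)
    · have hq : 0 ≤ h x ^ 2 * w x := mul_nonneg (sq_nonneg _) (hw0 x).le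
      rw [Real.norm_of_nonneg (mul_nonneg (sq_nonneg _) (hw0 x).le), mul_pow]
      nlinarith [hsq1 n x]
    · refine tendsto_const_nhds.congr' ?_
      filter_upwards [ptw x] with n hn
      rw [hn, one_mul]
  have lim2 : Tendsto (fun n => ∫ x, ‖gradient (fun x => χ n x * h x) x‖ ^ 2 * w x) atTop
      (𝓝 (∫ x, ‖gradient h x‖ ^ 2 * w x)) := by
    refine tendsto_integral_of_dominated_convergence
      (fun x => 2 * (‖gradient h x‖ ^ 2 * w x) + 2 * K ^ 2 * (h x ^ 2 * w x)) (fun n => ?_)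
      ((hi2.const_mul 2).add (hi1.const_mul _))
      (fun n => Eventually.of_forall fun x => ?_) (Eventually.of_forall fun x => ?_)
    · have := aux_grad0 (hm n)
      exact Continuous.aestronglyMeasurable (by fun_prop)
    · rw [Real.norm_of_nonneg (mul_nonneg (sq_nonneg _) (hw0 x).le),
        aux_gmul ((hχ1 n).differentiable one_ne_zero x) (hhd x)]
      have h1 : ‖χ n x • gradient h x + h x • gradient (χ n) x‖ ≤ ‖gradient h x‖ + |h x| * K := by
        refine (norm_add_le _ _).trans ?_
        rw [norm_smul, norm_smul, Real.norm_eq_abs, Real.norm_eq_abs, abs_of_nonneg (hχ3 n x).1]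
        gcongr
        · exact mul_le_of_le_one_left (norm_nonneg _) (hχ3 n x).2
        · exact hχ4 n x
      have h2 : ‖χ n x • gradient h x + h x • gradient (χ n) x‖ ^ 2 ≤
          2 * ‖gradient h x‖ ^ 2 + 2 * K ^ 2 * h x ^ 2 := by
        calc _ ≤ (‖gradient h x‖ + |h x| * K) ^ 2 := by gcongr
          _ ≤ 2 * ‖gradient h x‖ ^ 2 + 2 * (|h x| * K) ^ 2 := by
            nlinarith [sq_nonneg (‖gradient h x‖ - |h x| * K)]
          _ = _ := by rw [mul_pow, sq_abs]; ring
      nlinarith [mul_le_mul_of_nonneg_right h2 (hw0 x).le]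
    · refine tendsto_const_nhds.congr' ?_
      filter_upwards [hχ5 x] with n hn
      have : (fun x => χ n x * h x) =ᶠ[𝓝 x] h := by
        filter_upwards [hn] with y hy
        rw [hy, one_mul]
      rw [this.gradient_eq]
  exact le_of_tendsto_of_tendsto' ((lim1 _ hi1).const_mul θ)
    (lim2.add ((lim1 _ hi1.integrableOn).const_mul b)) step

theorem aux_psi (k : ℕ) (t : ℝ) :
    HasDerivAt (fun s : ℝ => max s 0 ^ (k + 2)) ((k + 2 : ℕ) * max t 0 ^ (k + 1)) t := by
  have hne : ∀ s : ℝ, s ≠ 0 → HasDerivAt (fun s : ℝ => max s 0 ^ (k + 2)) ((k + 2 : ℕ) * max s 0 ^ (k + 1)) s := by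
    intro s hs
    rcases lt_or_gt_of_ne hs with h | h
    · rw [max_eq_right h.le]
      have : (fun s : ℝ => max s 0 ^ (k + 2)) =ᶠ[𝓝 s] fun _ => (0 : ℝ) := by
        filter_upwards [gt_mem_nhds h] with y hy
        rw [max_eq_right hy.le]; simp
      simpa using (hasDerivAt_const s (0 : ℝ)).congr_of_eventuallyEq this
    · rw [max_eq_left h.le]
      have : (fun s : ℝ => max s 0 ^ (k + 2)) =ᶠ[𝓝 s] fun s => s ^ (k + 2) := by
        filter_upwards [lt_mem_nhds h] with y hy
        rw [max_eq_left hy.le]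
      exact (hasDerivAt_pow (k + 2) s).congr_of_eventuallyEq this
  by_cases ht : t = 0
  · subst ht
    refine hasDerivAt_of_hasDerivAt_of_ne (f := fun s : ℝ => max s 0 ^ (k + 2))
      (g := fun s : ℝ => (k + 2 : ℕ) * max s 0 ^ (k + 1)) (fun y hy => hne y hy) ?_ ?_
    · exact Continuous.continuousAt (by fun_prop)
    · exact Continuous.continuousAt (by fun_prop)
  · exact hne t ht

theorem aux_psi_C1 (k : ℕ) : ContDiff ℝ 1 (fun s : ℝ => max s 0 ^ (k + 2)) := by
  rw [contDiff_one_iff_deriv]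
  refine ⟨fun t => (aux_psi k t).differentiableAt, ?_⟩
  rw [show deriv (fun s : ℝ => max s 0 ^ (k + 2)) = fun t : ℝ => ((k + 2 : ℕ) : ℝ) * max t 0 ^ (k + 1) from
    funext fun t => (aux_psi k t).deriv]
  fun_prop

/-- localized bump `G`. -/
theorem aux_G {V : Euc d → ℝ} (hV : ContDiff ℝ 1 V) {A B : Set (Euc d)} (hA : IsOpen A)
    (hB : IsOpen B) (hAB : ∀ x, x ∈ A ∨ x ∈ B) {c : ℝ} (hc : ∀ x ∈ A ∩ B, c ≤ V x) :
    ∃ G : Euc d → ℝ, Continuous G ∧ (∀ x, 0 ≤ G x) ∧ (∀ x, G x ≠ 0 → x ∈ A ∧ x ∉ B ∧ G x = c - V x) ∧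
      (∀ x ∈ A, G x = max (c - V x) 0) ∧
      ∀ k : ℕ, ContDiff ℝ 1 (fun x => G x ^ (k + 2)) ∧
        ∀ x, gradient (fun x => G x ^ (k + 2)) x = (-((k + 2 : ℕ) * G x ^ (k + 1))) • gradient V x := by
  classical
  set G : Euc d → ℝ := fun x => if x ∈ A then max (c - V x) 0 else 0 with hG
  have hGA : ∀ x ∈ A, G x = max (c - V x) 0 := fun x hx => by simp [hG, hx]
  have hGB : ∀ x ∈ B, G x = 0 := by
    intro x hx
    by_cases hxA : x ∈ A
    · rw [hGA x hxA, max_eq_right]; linarith [hc x ⟨hxA, hx⟩]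
    · simp [hG, hxA]
  have eA : ∀ x ∈ A, G =ᶠ[𝓝 x] fun x => max (c - V x) 0 := fun x hx => by
    filter_upwards [hA.mem_nhds hx] with y hy using hGA y hy
  have eB : ∀ x ∈ B, G =ᶠ[𝓝 x] fun x => 0 := fun x hx => by
    filter_upwards [hB.mem_nhds hx] with y hy using hGB y hy
  have hVc := hV.continuous
  refine ⟨G, ?_, ?_, ?_, hGA, fun k => ⟨?_, ?_⟩⟩
  · rw [continuous_iff_continuousAt]
    intro x
    rcases hAB x with h | h
    · exact ContinuousAt.congr (Continuous.continuousAt (by fun_prop)) (eA x h).symm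
    · exact ContinuousAt.congr continuousAt_const (eB x h).symm
  · intro x
    simp only [hG]
    split_ifs <;> simp
  · intro x hx
    have hxA : x ∈ A := by
      by_contra h; exact hx (by simp [hG, h])
    refine ⟨hxA, fun h => hx (hGB x h), ?_⟩
    rw [hGA x hxA] at hx ⊢
    rcases le_total (c - V x) 0 with h | h
    · exact absurd (max_eq_right h) hx
    · exact max_eq_left h
  · rw [contDiff_iff_contDiffAt]
    intro x
    rcases hAB x with h | h
    · have : (fun x => G x ^ (k + 2)) =ᶠ[𝓝 x] (fun s : ℝ => max s 0 ^ (k + 2)) ∘ fun x => c - V x :=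
        (eA x h).mono fun y hy => by simp only [hy, Function.comp]
      exact ((aux_psi_C1 k).comp (contDiff_const.sub hV)).contDiffAt.congr_of_eventuallyEq this
    · have : (fun x => G x ^ (k + 2)) =ᶠ[𝓝 x] fun _ => 0 :=
        (eB x h).mono fun y hy => by simp [hy]
      exact contDiffAt_const.congr_of_eventuallyEq this
  · intro x
    rcases hAB x with h | h
    · have : (fun x => G x ^ (k + 2)) =ᶠ[𝓝 x] fun x => (fun s : ℝ => max (c - s) 0 ^ (k + 2)) (V x) :=
        (eA x h).mono fun y hy => by simp only [hy]
      rw [this.gradient_eq, hGA x h]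
      refine aux_gcomp (φ := fun s : ℝ => max (c - s) 0 ^ (k + 2)) ?_ (hV.differentiable one_ne_zero x)
      have h1 := (aux_psi k (c - V x)).comp (V x) ((hasDerivAt_id (V x)).const_sub c)
      refine h1.congr_deriv ?_
      simp
    · have : (fun x => G x ^ (k + 2)) =ᶠ[𝓝 x] fun _ => 0 :=
        (eB x h).mono fun y hy => by simp [hy]
      rw [this.gradient_eq, hGB x h]
      simp

theorem aux_CS {f g : Euc d → ℝ} {μ : Measure (Euc d)} (h1 : Integrable (fun x => f x ^ 2) μ)
    (h2 : Integrable (fun x => g x ^ 2) μ) (h3 : Integrable (fun x => f x * g x) μ) :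
    (∫ x, f x * g x ∂μ) ^ 2 ≤ (∫ x, f x ^ 2 ∂μ) * ∫ x, g x ^ 2 ∂μ := by
  have : ∀ t : ℝ, 0 ≤ (∫ x, g x ^ 2 ∂μ) * (t * t) + (2 * ∫ x, f x * g x ∂μ) * t + ∫ x, f x ^ 2 ∂μ := by
    intro t
    have h : 0 ≤ ∫ x, (t * t) * g x ^ 2 + (2 * t) * (f x * g x) + f x ^ 2 ∂μ :=
      integral_nonneg fun x => by
        show 0 ≤ (t * t) * g x ^ 2 + (2 * t) * (f x * g x) + f x ^ 2
        nlinarith [sq_nonneg (f x + t * g x)]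
    rw [integral_add (f := fun x => (t * t) * g x ^ 2 + (2 * t) * (f x * g x)) ((h2.const_mul _).add (h3.const_mul _)) h1, integral_add (h2.const_mul _) (h3.const_mul _),
      integral_const_mul, integral_const_mul] at h
    linarith
  have := discrim_le_zero this
  rw [discrim] at this
  nlinarith

theorem aux_unif {U : Set (Euc d)} (g : Euc d → ℝ) :
    ∫ x, g x ∂(uniformOn U) = (volume U).toReal⁻¹ * ∫ x in U, g x := by
  rw [uniformOn, integral_smul_measure, ENNReal.toReal_inv, smul_eq_mul]

theorem aux_gcoord (e x : Euc d) (m : ℝ) : gradient (fun y : Euc d => ⟪e, y⟫ - m) x = e := by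
  have h : HasFDerivAt (fun y : Euc d => ⟪e, y⟫ - m) (InnerProductSpace.toDual ℝ (Euc d) e) x :=
    ((InnerProductSpace.toDual ℝ (Euc d) e).hasFDerivAt).sub_const m
  rw [gradient, h.fderiv]; simp

set_option maxHeartbeats 600000 in
theorem aux_lam {V : Euc d → ℝ} (hV : ContDiff ℝ 2 V) {S : Set (Euc d)}
    {r ν M lam : ℝ} (hr : 0 < r) (hν : 0 < ν) (hM : 0 < M)
    (hmin0 : ∀ x, 0 ≤ V x) {p : Euc d} (hp : p ∈ S) (hp0 : V p = 0)
    (hlow : ∀ x, infDist x S < 2 * r / 3 → ν * infDist x S ^ 2 / 8 ≤ V x)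
    (hPL : ∀ x, infDist x S < r / 2 → ν * V x ≤ ‖gradient V x‖ ^ 2)
    (hlap : ∀ x, infDist x S < r / 2 → lap V x ≤ M)
    (hUc : IsCompact {y : Euc d | infDist y S ≤ r})
    {e : Euc d} (he : ‖e‖ = 1)
    (hPI : PoincareIneq (uniformOn {y : Euc d | infDist y S ≤ r}) lam) :
    0 < lam ∧ lam * (ν * (ν * r ^ 2 / 72)) ≤ (8 * M / 3) * (M / 4 + ν) := by
  set U := {y : Euc d | infDist y S ≤ r} with hU
  set c := ν * r ^ 2 / 72 with hc
  have hc0 : 0 < c := by positivity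
  have hV1 : ContDiff ℝ 1 V := hV.of_le (by norm_num)
  have hgV := aux_grad0 hV1
  have hlc := aux_lap_cont hV
  have hdc : Continuous (fun x => infDist x S) := continuous_infDist_pt S
  obtain ⟨G, hGc, hG0, hGs, hGA, hGk⟩ := aux_G hV1 (A := {x | infDist x S < r / 2}) (B := {x | r / 3 < infDist x S})
    (isOpen_lt hdc continuous_const) (isOpen_lt continuous_const hdc)
    (fun x => by
      by_cases h : infDist x S < r / 2
      · exact Or.inl h
      · right; show r / 3 < infDist x S; linarith) (c := c)
    (by
      rintro x ⟨h1, h2⟩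
      simp only [mem_setOf_eq] at h1 h2
      have := hlow x (by linarith)
      have h3 : (r / 3) ^ 2 ≤ infDist x S ^ 2 := by gcongr
      rw [hc]; nlinarith)
  have hGsub : Function.support G ⊆ U := fun x hx => by
    have := (hGs x hx).1
    simp only [mem_setOf_eq] at this
    show infDist x S ≤ r; linarith
  have hsub : ∀ k : ℕ, Function.support (fun x => G x ^ (k + 1)) ⊆ U := fun k x hx =>
    hGsub (fun h => hx (by simp [h]))
  have hcs : ∀ k : ℕ, HasCompactSupport (fun x => G x ^ (k + 1)) := fun k =>
    HasCompactSupport.of_support_subset_isCompact hUc (hsub k)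
  have hGi : ∀ k : ℕ, Integrable (fun x => G x ^ (k + 1)) := fun k =>
    Continuous.integrable_of_hasCompactSupport (by fun_prop) (hcs k)
  have hGVi : ∀ k : ℕ, Integrable (fun x => G x ^ (k + 1) * ‖gradient V x‖ ^ 2) := fun k =>
    Continuous.integrable_of_hasCompactSupport (by fun_prop) (hcs k).mul_right
  have hibp : ∀ k : ℕ, (k + 2 : ℕ) * ∫ x, G x ^ (k + 1) * ‖gradient V x‖ ^ 2 ≤ M * ∫ x, G x ^ (k + 2) := by
    intro k
    have h := aux_ibp2 hV (hGk k).1 (hcs (k + 1))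
    have e1 : ∫ x, ⟪gradient (fun x => G x ^ (k + 2)) x, gradient V x⟫ =
        -((k + 2 : ℕ) * ∫ x, G x ^ (k + 1) * ‖gradient V x‖ ^ 2) := by
      rw [← integral_const_mul, ← integral_neg]
      refine integral_congr_ae (Eventually.of_forall fun x => ?_)
      simp only
      rw [(hGk k).2, inner_smul_left, real_inner_self_eq_norm_sq]
      simp only [conj_trivial]; ring
    rw [e1, neg_inj] at h
    rw [h, ← integral_const_mul]
    refine integral_mono (Continuous.integrable_of_hasCompactSupport (by fun_prop) (hcs (k + 1)).mul_right)
      ((hGi (k + 1)).const_mul M) fun x => ?_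
    simp only
    by_cases hx : G x = 0
    · simp [hx]
    · have := hlap x (hGs x hx).1
      have h0 : 0 ≤ G x ^ (k + 2) := pow_nonneg (hG0 x) _
      nlinarith
  have hpos : ∀ k : ℕ, 0 < ∫ x, G x ^ (k + 1) := by
    intro k
    refine (integral_pos_iff_support_of_nonneg (fun x => pow_nonneg (hG0 x) _) (hGi k)).2 ?_
    refine (IsOpen.measure_pos volume (Continuous.isOpen_support (by fun_prop)) ⟨p, ?_⟩)
    have hpA : infDist p S < r / 2 := by rw [infDist_zero_of_mem hp]; positivity
    have : G p = c := by rw [hGA p hpA, hp0, sub_zero, max_eq_left hc0.le]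
    simp [this, hc0.ne']
  have hPLi : ν * c * ∫ x, G x ^ 3 ≤ (M / 4 + ν) * ∫ x, G x ^ 4 := by
    have h1 : ∫ x, (ν * c) * G x ^ 3 ≤ ∫ x, (G x ^ 3 * ‖gradient V x‖ ^ 2 + ν * G x ^ 4) := by
      refine integral_mono ((hGi 2).const_mul _) ((hGVi 2).add ((hGi 3).const_mul ν)) fun x => ?_
      simp only
      by_cases hx : G x = 0
      · simp [hx]
      · have h2 := hPL x (hGs x hx).1
        have h3 : V x = c - G x := by linarith [(hGs x hx).2.2]
        have h0 : 0 ≤ G x ^ 3 := pow_nonneg (hG0 x) _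
        rw [h3] at h2
        have := mul_le_mul_of_nonneg_left h2 h0
        nlinarith
    rw [integral_const_mul, integral_add (hGVi 2) ((hGi 3).const_mul ν), integral_const_mul] at h1
    have h2 := hibp 2
    norm_num at h2
    linarith
  have hUne : (interior U).Nonempty := by
    refine ⟨p, mem_interior_iff_mem_nhds.2 ?_⟩
    filter_upwards [ball_mem_nhds p hr] with y hy
    exact (infDist_le_dist_of_mem hp).trans (mem_ball.1 hy).le
  have hv0 : volume U ≠ 0 := (Measure.measure_pos_of_nonempty_interior _ hUne).ne'
  have hvt : volume U ≠ ⊤ := hUc.measure_lt_top.ne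
  set m := (volume U).toReal with hm
  have hm0 : 0 < m := ENNReal.toReal_pos hv0 hvt
  have huni : ∀ g : Euc d → ℝ, ∫ x, g x ∂(uniformOn U) = m⁻¹ * ∫ x in U, g x := aux_unif
  have hui : ∀ g : Euc d → ℝ, Continuous g → Integrable g (uniformOn U) := by
    intro g hg
    exact (hg.continuousOn.integrableOn_compact hUc).integrable.smul_measure (ENNReal.inv_ne_top.2 hv0)
  have hprob : IsProbabilityMeasure (uniformOn U) := by
    constructor
    rw [uniformOn, Measure.smul_apply, Measure.restrict_apply_univ, smul_eq_mul, ENNReal.inv_mul_cancel hv0 hvt]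
  have hfull : ∀ g : Euc d → ℝ, Function.support g ⊆ U → ∫ x, g x ∂(uniformOn U) = m⁻¹ * ∫ x, g x := by
    intro g hg
    rw [huni, setIntegral_eq_integral_of_forall_compl_eq_zero]
    intro x hx
    by_contra h
    exact hx (hg h)
  -- test function G^2
  set φ : Euc d → ℝ := fun x => G x ^ 2 with hφ
  have hφC : ContDiff ℝ 1 φ := (hGk 0).1
  have hφc := hφC.continuous
  have hgφ := aux_grad0 hφC
  have hφg : ∀ x, ‖gradient φ x‖ ^ 2 = 4 * (G x ^ 2 * ‖gradient V x‖ ^ 2) := by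
    intro x
    rw [hφ, (hGk 0).2, norm_smul, mul_pow, Real.norm_eq_abs, sq_abs]
    push_cast; ring
  set D := ∫ x, ‖gradient φ x‖ ^ 2 ∂(uniformOn U) with hD
  have hD0 : 0 ≤ D := integral_nonneg fun x => by positivity
  have hDle : D ≤ (4 * M / 3) * (m⁻¹ * ∫ x, G x ^ 3) := by
    have e1 : D = 4 * (m⁻¹ * ∫ x, G x ^ 2 * ‖gradient V x‖ ^ 2) := by
      rw [hD]
      simp_rw [hφg]
      rw [integral_const_mul, hfull]
      intro x hx
      exact hsub 1 (fun h => hx (by simp only [] at h ⊢; rw [h, zero_mul]))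
    have h2 := hibp 1
    norm_num at h2
    have h3 := mul_le_mul_of_nonneg_left h2 (inv_pos.2 hm0).le
    rw [e1]; nlinarith
  have hEφ : ∫ x, φ x ∂(uniformOn U) = m⁻¹ * ∫ x, G x ^ 2 := hfull _ (hsub 1)
  have hEφ2 : ∫ x, φ x ^ 2 ∂(uniformOn U) = m⁻¹ * ∫ x, G x ^ 4 := by
    rw [hfull]
    · congr 2; funext x; simp only [hφ]; ring
    · intro x hx
      exact hsub 1 (fun h => hx (by simp only [hφ] at h ⊢; rw [h]; simp))
  have hpi1 := hPI φ hφC (hui _ (by fun_prop)) (hui _ (by fun_prop))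
  set a := ∫ x, φ x ∂(uniformOn U) with ha
  have hvar : ∫ x, (φ x - a) ^ 2 ∂(uniformOn U) = (∫ x, φ x ^ 2 ∂(uniformOn U)) - a ^ 2 := by
    have : ∀ x, (φ x - a) ^ 2 = φ x ^ 2 + ((-(2 * a)) * φ x + a ^ 2) := fun x => by ring
    simp_rw [this]
    rw [integral_add (hui _ (by fun_prop)) (hui _ (by fun_prop)),
      integral_add (hui _ (by fun_prop)) (hui _ (by fun_prop)), integral_const_mul, ← ha]
    simp
    ring
  -- coordinate test function
  set g : Euc d → ℝ := fun y => ⟪e, y⟫ - 0 with hg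
  have hgC : ContDiff ℝ 1 g := (contDiff_const.inner ℝ contDiff_id).sub contDiff_const
  have hgg : ∀ x, gradient g x = e := fun x => aux_gcoord e x 0
  have hpi2 := hPI g hgC (hui _ (by have := hgC.continuous; fun_prop))
    (hui _ (by have := aux_grad0 hgC; fun_prop))
  set mg := ∫ x, g x ∂(uniformOn U) with hmg
  have hpi2' : ∫ x, (g x - mg) ^ 2 ∂(uniformOn U) ≤ 1 / lam := by
    refine hpi2.trans (le_of_eq ?_)
    simp_rw [hgg, he]
    simp
  set w : Euc d → ℝ := fun x => g x - mg with hw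
  have hwC : ContDiff ℝ 1 w := hgC.sub contDiff_const
  have hwc := hwC.continuous
  have hwf : ∀ x, fderiv ℝ w x e = 1 := by
    intro x
    have h1 : gradient w x = e := by
      have : w = fun y => ⟪e, y⟫ - mg := by funext y; simp [hw, hg]
      rw [this]; exact aux_gcoord e x mg
    rw [← inner_gradient_left, h1, real_inner_self_eq_norm_sq, he]; norm_num
  have hibpφ := aux_ibp1 hφC (hcs 1) hwC e
  simp_rw [hwf, mul_one] at hibpφ
  have ha1 : a = -∫ x, ⟪gradient φ x, e⟫ * w x ∂(uniformOn U) := by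
    rw [hfull, hibpφ, hEφ]
    · simp [hφ]
    · intro x hx
      refine hGsub fun h => hx ?_
      simp only [hφ]
      rw [(hGk 0).2, h]; simp
  have hcsq := aux_CS (f := fun x => ⟪gradient φ x, e⟫) (g := w) (μ := uniformOn U)
    (hui _ (by fun_prop)) (hui _ (by fun_prop)) (hui _ (by fun_prop))
  have hin : ∫ x, ⟪gradient φ x, e⟫ ^ 2 ∂(uniformOn U) ≤ D := by
    refine integral_mono (hui _ (by fun_prop)) (hui _ (by fun_prop)) fun x => ?_
    simp only
    have := abs_real_inner_le_norm (gradient φ x) e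
    rw [he, mul_one] at this
    rw [← sq_abs]
    gcongr
  have hw2 : 0 ≤ ∫ x, w x ^ 2 ∂(uniformOn U) := integral_nonneg fun x => sq_nonneg _
  have ha2 : a ^ 2 ≤ D * (1 / lam) := by
    calc a ^ 2 = (∫ x, ⟪gradient φ x, e⟫ * w x ∂(uniformOn U)) ^ 2 := by rw [ha1]; ring
      _ ≤ _ := hcsq
      _ ≤ D * (1 / lam) := mul_le_mul hin hpi2' hw2 hD0
  have hapos : 0 < a := by
    rw [hEφ]; exact mul_pos (inv_pos.2 hm0) (hpos 1)
  have hlam : 0 < lam := by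
    by_contra h
    push Not at h
    have : 1 / lam ≤ 0 := one_div_nonpos.2 h
    have : D * (1 / lam) ≤ 0 := mul_nonpos_of_nonneg_of_nonpos hD0 this
    have : 0 < a ^ 2 := by positivity
    linarith
  refine ⟨hlam, ?_⟩
  rw [hvar, hEφ2, ← hD] at hpi1
  have h5 : m⁻¹ * (∫ x, G x ^ 4) ≤ (1 / lam) * (2 * D) := by linarith
  have h6 : lam * (m⁻¹ * ∫ x, G x ^ 4) ≤ 2 * D := by
    have h55 := mul_le_mul_of_nonneg_left h5 hlam.le
    rwa [← mul_assoc lam (1 / lam), mul_one_div_cancel hlam.ne', one_mul] at h55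
  have h7 : lam * ∫ x, G x ^ 4 ≤ (8 * M / 3) * ∫ x, G x ^ 3 := by
    have : m⁻¹ * (lam * ∫ x, G x ^ 4) ≤ m⁻¹ * ((8 * M / 3) * ∫ x, G x ^ 3) := by linarith
    exact le_of_mul_le_mul_left this (inv_pos.2 hm0)
  have hI4 := hpos 3
  have h8 : (lam * (ν * c)) * ∫ x, G x ^ 4 ≤ ((8 * M / 3) * (M / 4 + ν)) * ∫ x, G x ^ 4 := by
    have hA := mul_le_mul_of_nonneg_left h7 (by positivity : 0 ≤ ν * c)
    have hB := mul_le_mul_of_nonneg_left hPLi (by positivity : 0 ≤ 8 * M / 3)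
    nlinarith
  exact le_of_mul_le_mul_right h8 hI4

theorem aux_dim1 {V : Euc 1 → ℝ} (hV : ContDiff ℝ 1 V) {p0 p1 : Euc 1} (hlt : V p0 < V p1)
    (hp1 : IsLocalMin V p1)
    (hseg : ∀ t ∈ Icc (0 : ℝ) 1, gradient V (p0 + t • (p1 - p0)) = 0 →
      IsLocalMin V (p0 + t • (p1 - p0))) : False := by
  set v := p1 - p0 with hv
  have hv0 : v ≠ 0 := by
    intro h
    rw [hv, sub_eq_zero] at h
    rw [h] at hlt; exact lt_irrefl _ hlt
  set γ : ℝ → ℝ := fun t => V (p0 + t • v) with hγ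
  have hl : Continuous (fun t : ℝ => p0 + t • v) := by fun_prop
  have hγc : Continuous γ := hV.continuous.comp hl
  set T : Set ℝ := Icc 0 1 ∩ {t | ∀ s ∈ Icc (0 : ℝ) 1, γ s ≤ γ t} with hT
  have hTc : IsCompact T := by
    refine isCompact_Icc.inter_right ?_
    have : {t | ∀ s ∈ Icc (0 : ℝ) 1, γ s ≤ γ t} = ⋂ s ∈ Icc (0 : ℝ) 1, {t | γ s ≤ γ t} := by
      ext t; simp
    rw [this]
    exact isClosed_biInter fun s _ => isClosed_le continuous_const hγc
  have hTne : T.Nonempty := by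
    obtain ⟨t, ht, hm⟩ := isCompact_Icc.exists_isMaxOn (nonempty_Icc.2 (zero_le_one (α := ℝ))) hγc.continuousOn
    exact ⟨t, ht, fun s hs => hm hs⟩
  obtain ⟨t, ⟨ht, htm⟩, hleast⟩ := hTc.exists_isLeast hTne
  have e0 : γ 0 = V p0 := by simp [hγ]
  have e1 : γ 1 = V p1 := by simp [hγ, hv]
  have htpos : 0 < t := by
    rcases ht.1.eq_or_lt with h | h
    · have := htm 1 ⟨zero_le_one, le_rfl⟩
      rw [← h, e0, e1] at this; linarith
    · exact h
  have hlm : IsLocalMin V (p0 + t • v) := by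
    rcases ht.2.eq_or_lt with h | h
    · rw [h]; simpa [hv] using hp1
    · apply hseg t ht
      have hmax : IsLocalMax γ t := by
        filter_upwards [Icc_mem_nhds htpos h] with s hs using htm s hs
      have := hmax.hasDerivAt_eq_zero (aux_line hV p0 v t)
      rw [PiLp.inner_apply] at this
      simp at this
      rcases this with h0 | h0
      · exact absurd (by ext i; fin_cases i; simpa using h0) hv0
      · ext i; fin_cases i; simpa using h0
  have hev : ∀ᶠ s in 𝓝 t, γ t ≤ γ s := (hl.tendsto t).eventually hlm
  have hev2 : ∀ᶠ s in 𝓝[<] t, γ t ≤ γ s ∧ 0 < s ∧ s < t := by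
    filter_upwards [hev.filter_mono nhdsWithin_le_nhds, (lt_mem_nhds htpos).filter_mono nhdsWithin_le_nhds,
      self_mem_nhdsWithin] with s h1 h2 h3
    exact ⟨h1, h2, h3⟩
  obtain ⟨s, h1, h2, h3⟩ := hev2.exists
  have : t ≤ s := hleast ⟨⟨h2.le, h3.le.trans ht.2⟩, fun q hq => (htm q hq).trans h1⟩
  linarith

theorem aux_conn {S S0 S1 : Set (Euc d)} {r lam : ℝ} (hr : 0 < r)
    (hS : IsCompact S) (h0n : S0.Nonempty) (h1n : S1.Nonempty) (hSu : S = S0 ∪ S1)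
    (hUc : IsCompact {y : Euc d | infDist y S ≤ r})
    (hPI : PoincareIneq (uniformOn {y : Euc d | infDist y S ≤ r}) lam) :
    ∃ x, infDist x S0 ≤ r ∧ infDist x S1 ≤ r := by
  by_contra hcon
  push Not at hcon
  set U := {y : Euc d | infDist y S ≤ r} with hU
  have hc0 : IsClosed {y : Euc d | infDist y S0 ≤ r} := isClosed_le (continuous_infDist_pt _) continuous_const
  have hc1 : IsClosed {y : Euc d | infDist y S1 ≤ r} := isClosed_le (continuous_infDist_pt _) continuous_const
  have hdj : Disjoint {y : Euc d | infDist y S0 ≤ r} {y : Euc d | infDist y S1 ≤ r} := by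
    rw [Set.disjoint_left]
    intro x hx hx1
    exact absurd hx1 (not_le.2 (hcon x hx))
  obtain ⟨F, hF0, hF1, hF01⟩ := exists_contMDiffMap_zero_one_of_isClosed (n := 1) (modelWithCornersSelf ℝ (Euc d)) hc0 hc1 hdj
  set f : Euc d → ℝ := fun x => F x with hf
  have hfC : ContDiff ℝ 1 f := F.contMDiff.contDiff
  have hfc := hfC.continuous
  have hfg := aux_grad0 hfC
  have hUmem : ∀ x ∈ U, infDist x S0 ≤ r ∨ infDist x S1 ≤ r := by
    intro x hx
    obtain ⟨q, hq, hqd⟩ := hS.exists_infDist_eq_dist (by rw [hSu]; exact h0n.inl) x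
    have hx' : infDist x S ≤ r := hx
    rw [hSu] at hq
    rcases hq with hq | hq
    · left; exact (infDist_le_dist_of_mem hq).trans (by rw [← hqd]; exact hx')
    · right; exact (infDist_le_dist_of_mem hq).trans (by rw [← hqd]; exact hx')
  have hgz : ∀ x ∈ U, gradient f x = 0 := by
    intro x hx
    rcases hUmem x hx with h | h
    · have h0 : f x = 0 := hF0 h
      refine aux_grad_zero (Eventually.of_forall fun y => ?_)
      rw [h0]; exact (hF01 y).1
    · have h0 : f x = 1 := hF1 h
      have : IsLocalMax f x := Eventually.of_forall fun y => by
        show f y ≤ f x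
        rw [h0]; exact (hF01 y).2
      rw [gradient, this.fderiv_eq_zero]; simp
  have hball : ∀ p ∈ S, ball p r ⊆ U := fun p hp y hy =>
    (infDist_le_dist_of_mem hp).trans (mem_ball.1 hy).le
  obtain ⟨p0, hp0⟩ := h0n
  obtain ⟨p1, hp1⟩ := h1n
  have hp0S : p0 ∈ S := by rw [hSu]; exact Or.inl hp0
  have hp1S : p1 ∈ S := by rw [hSu]; exact Or.inr hp1
  have hv0 : volume U ≠ 0 := ((measure_ball_pos volume p0 hr).trans_le (measure_mono (hball p0 hp0S))).ne'
  have hvt : volume U ≠ ⊤ := hUc.measure_lt_top.ne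
  have hm0 : 0 < (volume U).toReal := ENNReal.toReal_pos hv0 hvt
  have hui : ∀ g : Euc d → ℝ, Continuous g → Integrable g (uniformOn U) := by
    intro g hg
    exact (hg.continuousOn.integrableOn_compact hUc).integrable.smul_measure (ENNReal.inv_ne_top.2 hv0)
  have h := hPI f hfC (hui _ (by fun_prop)) (hui _ (by fun_prop))
  set a := ∫ x, f x ∂(uniformOn U) with ha
  have hz : ∫ x, ‖gradient f x‖ ^ 2 ∂(uniformOn U) = 0 := by
    rw [aux_unif, setIntegral_congr_fun (g := fun _ => (0 : ℝ)) hUc.measurableSet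
      (fun x hx => by simp [hgz x hx])]
    simp
  rw [hz, mul_zero, aux_unif] at h
  have hint : IntegrableOn (fun x => (f x - a) ^ 2) U volume :=
    (Continuous.continuousOn (by fun_prop)).integrableOn_compact hUc
  have h2 : ∫ x in U, (f x - a) ^ 2 = 0 := by
    apply le_antisymm
    · by_contra hc
      push Not at hc
      have := mul_pos (inv_pos.2 hm0) hc
      linarith
    · exact integral_nonneg fun x => sq_nonneg _
  rw [setIntegral_eq_zero_iff_of_nonneg_ae (Eventually.of_forall fun x => sq_nonneg _) hint] at h2
  have hpt : ∀ p ∈ S, ∃ x ∈ ball p r, f x = a := by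
    intro p hp
    by_contra hc
    push Not at hc
    have h3 := ae_restrict_of_ae_restrict_of_subset (hball p hp) h2
    have h3 := (ae_restrict_iff' measurableSet_ball).1 h3
    have h4 : volume (ball p r) = 0 := by
      refine measure_mono_null (fun x hx => ?_) h3
      intro h5
      have h6 := h5 hx
      simp only [Pi.zero_apply] at h6
      exact hc x hx (by have := pow_eq_zero_iff (two_ne_zero) |>.1 h6; linarith)
    exact (measure_ball_pos volume p hr).ne' h4
  obtain ⟨x, hx, hxa⟩ := hpt p0 hp0S
  obtain ⟨y, hy, hya⟩ := hpt p1 hp1S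
  have hx0 : f x = 0 := hF0 ((infDist_le_dist_of_mem hp0).trans (mem_ball.1 hx).le)
  have hy1 : f y = 1 := hF1 ((infDist_le_dist_of_mem hp1).trans (mem_ball.1 hy).le)
  linarith

theorem aux_Z_pos {V : Euc d → ℝ} {ε : ℝ} (hZ : Integrable (fun x => exp (-V x / ε))) :
    0 < ∫ x, exp (-V x / ε) := integral_exp_pos hZ

theorem aux_gibbs_int {V : Euc d → ℝ} (hV : Continuous V) {ε : ℝ}
    (hZ : Integrable (fun x => exp (-V x / ε))) (g : Euc d → ℝ) :
    ∫ x, g x ∂(gibbs V ε) = (∫ x, exp (-V x / ε))⁻¹ * ∫ x, g x * exp (-V x / ε) := by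
  have hm : Measurable (fun x => ENNReal.ofReal (exp (-V x / ε))) := by
    have := hV.measurable
    fun_prop
  rw [gibbs, integral_smul_measure, ENNReal.toReal_inv, ENNReal.toReal_ofReal (aux_Z_pos hZ).le,
    smul_eq_mul, integral_withDensity_eq_integral_toReal_smul hm (by simp)]
  congr 2
  funext x
  rw [ENNReal.toReal_ofReal (exp_pos _).le, smul_eq_mul, mul_comm]

theorem aux_gibbs_integrable {V : Euc d → ℝ} (hV : Continuous V) {ε : ℝ}
    (hZ : Integrable (fun x => exp (-V x / ε))) {g : Euc d → ℝ} (hg : Integrable g (gibbs V ε)) :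
    Integrable (fun x => g x * exp (-V x / ε)) := by
  have hm : Measurable (fun x => ENNReal.ofReal (exp (-V x / ε))) := by
    have := hV.measurable
    fun_prop
  rw [gibbs, integrable_smul_measure (by simp) (by simpa using aux_Z_pos hZ),
    integrable_withDensity_iff_integrable_smul' hm (by simp)] at hg
  refine hg.congr (Eventually.of_forall fun x => ?_)
  simp only
  rw [ENNReal.toReal_ofReal (exp_pos _).le, smul_eq_mul, mul_comm]

theorem aux_gibbs_prob {V : Euc d → ℝ} {ε : ℝ}
    (hZ : Integrable (fun x => exp (-V x / ε))) : IsProbabilityMeasure (gibbs V ε) := by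
  constructor
  rw [gibbs, Measure.smul_apply, withDensity_apply _ MeasurableSet.univ, Measure.restrict_univ,
    ← ofReal_integral_eq_lintegral_ofReal hZ (Eventually.of_forall fun x => (exp_pos _).le), smul_eq_mul]
  exact ENNReal.inv_mul_cancel (by simpa using aux_Z_pos hZ) (by simp)

theorem aux_var {μ : Measure (Euc d)} [IsProbabilityMeasure μ] {f : Euc d → ℝ} (hf : Continuous f)
    (h2 : Integrable (fun x => f x ^ 2) μ) (a : ℝ) :
    Integrable (fun x => (f x - a) ^ 2) μ ∧
    ∫ x, (f x - ∫ y, f y ∂μ) ^ 2 ∂μ ≤ ∫ x, (f x - a) ^ 2 ∂μ := by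
  have h1 : Integrable f μ :=
    ((memLp_two_iff_integrable_sq hf.aestronglyMeasurable).2 h2).integrable one_le_two
  have hi : ∀ b : ℝ, Integrable (fun x => (f x - b) ^ 2) μ := by
    intro b
    have : (fun x => (f x - b) ^ 2) = fun x => f x ^ 2 + ((-(2 * b)) * f x + b ^ 2) := by
      funext x; ring
    rw [this]
    exact h2.add ((h1.const_mul _).add (integrable_const _))
  have he : ∀ b : ℝ, ∫ x, (f x - b) ^ 2 ∂μ = (∫ x, f x ^ 2 ∂μ) - 2 * b * (∫ x, f x ∂μ) + b ^ 2 := by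
    intro b
    have : (fun x => (f x - b) ^ 2) = fun x => f x ^ 2 + ((-(2 * b)) * f x + b ^ 2) := by
      funext x; ring
    rw [this, integral_add (g := fun x => (-(2 * b)) * f x + b ^ 2) h2 ((h1.const_mul _).add (integrable_const _)),
      integral_add (h1.const_mul _) (integrable_const _), integral_const_mul]
    simp
    ring
  refine ⟨hi a, ?_⟩
  rw [he, he]
  nlinarith [sq_nonneg (a - ∫ x, f x ∂μ)]

/-- abstract perturbation step. -/
theorem aux_perturb {V : Euc d → ℝ} (hV : ContDiff ℝ 2 V) {ε : ℝ} (hε : 0 < ε)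
    (hmin0 : ∀ x, 0 ≤ V x)
    (hZ : Integrable (fun x => exp (-V x / ε)))
    {U : Set (Euc d)} (hUc : IsCompact U) (hv0 : volume U ≠ 0) {θ b lam K : ℝ} (hθ : 0 < θ) (hb : 0 ≤ b)
    (hΨ1 : ∀ x ∉ U, θ ≤ ‖gradient V x‖ ^ 2 / (4 * ε ^ 2) - lap V x / (2 * ε))
    (hΨ2 : ∀ x, θ - b ≤ ‖gradient V x‖ ^ 2 / (4 * ε ^ 2) - lap V x / (2 * ε))
    (hK : ∀ x ∈ U, V x ≤ K * ε) (hlam : 0 < lam) (hPI : PoincareIneq (uniformOn U) lam)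
    {ρ : ℝ} (hρ : (1 / θ) * (1 + b * exp K / lam) ≤ 1 / ρ) :
    PoincareIneq (gibbs V ε) ρ := by
  intro f hf hf2 hfg
  have hVc := hV.continuous
  have := aux_gibbs_prob hZ
  have hfc := hf.continuous
  have hgf := aux_grad0 hf
  set w : Euc d → ℝ := fun x => exp (-V x / ε) with hw
  have hwc : Continuous w := by rw [hw]; fun_prop
  have hw0 : ∀ x, 0 < w x := fun x => exp_pos _
  set a := ∫ x, f x ∂(uniformOn U) with ha
  obtain ⟨hia, hva⟩ := aux_var hfc hf2 a
  refine hva.trans ?_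
  have hgsub : ∀ x, gradient (fun y => f y - a) x = gradient f x := by
    intro x
    simp only [gradient, fderiv_sub_const]
  have hi1 := aux_gibbs_integrable hVc hZ hia
  have hi2 := aux_gibbs_integrable hVc hZ hfg
  have key := aux_lyap_ext hV hε hUc.measurableSet hΨ1 hΨ2 (h := fun y => f y - a)
    (hf.sub contDiff_const) hi1 (by simp_rw [hgsub]; exact hi2)
  simp_rw [hgsub] at key
  have hui : ∀ g : Euc d → ℝ, Continuous g → Integrable g (uniformOn U) := by
    intro g hg
    exact (hg.continuousOn.integrableOn_compact hUc).integrable.smul_measure (ENNReal.inv_ne_top.2 hv0)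
  have hm0 : 0 < (volume U).toReal := ENNReal.toReal_pos hv0 hUc.measure_lt_top.ne
  have hp := hPI f hf (hui _ (by fun_prop)) (hui _ (by fun_prop))
  rw [← ha, aux_unif, aux_unif] at hp
  have hp2 : ∫ x in U, (f x - a) ^ 2 ≤ (1 / lam) * ∫ x in U, ‖gradient f x‖ ^ 2 := by
    have : (volume U).toReal⁻¹ * (∫ x in U, (f x - a) ^ 2) ≤
      (volume U).toReal⁻¹ * ((1 / lam) * ∫ x in U, ‖gradient f x‖ ^ 2) := by linarith
    exact le_of_mul_le_mul_left this (inv_pos.2 hm0)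
  have hco : ∀ g : Euc d → ℝ, Continuous g → IntegrableOn g U := fun g hg =>
    hg.continuousOn.integrableOn_compact hUc
  have hA : ∫ x in U, (f x - a) ^ 2 * w x ≤ ∫ x in U, (f x - a) ^ 2 := by
    refine setIntegral_mono (hco _ (by fun_prop)) (hco _ (by fun_prop)) fun x => ?_
    refine mul_le_of_le_one_right (sq_nonneg _) ?_
    rw [hw]
    apply exp_le_one_iff.2
    exact div_nonpos_of_nonpos_of_nonneg (by linarith [hmin0 x]) hε.le
  have hB : ∫ x in U, ‖gradient f x‖ ^ 2 ≤ exp K * ∫ x in U, ‖gradient f x‖ ^ 2 * w x := by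
    rw [← integral_const_mul]
    refine setIntegral_mono_on (hco _ (by fun_prop)) (hco _ (by fun_prop)) hUc.measurableSet fun x hx => ?_
    have h1 : 1 ≤ exp K * w x := by
      rw [hw, ← exp_add]
      apply one_le_exp
      rw [neg_div, ← sub_eq_add_neg, sub_nonneg, div_le_iff₀ hε]
      exact hK x hx
    nlinarith [sq_nonneg ‖gradient f x‖]
  have hC : ∫ x in U, ‖gradient f x‖ ^ 2 * w x ≤ ∫ x, ‖gradient f x‖ ^ 2 * w x :=
    setIntegral_le_integral hi2 (Eventually.of_forall fun x => mul_nonneg (sq_nonneg _) (hw0 x).le)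
  set I := ∫ x, ‖gradient f x‖ ^ 2 * w x with hI
  have hI0 : 0 ≤ I := integral_nonneg fun x => mul_nonneg (sq_nonneg _) (hw0 x).le
  have hD : ∫ x in U, (f x - a) ^ 2 * w x ≤ (1 / lam) * (exp K * I) := by
    refine hA.trans (hp2.trans ?_)
    have : exp K * ∫ x in U, ‖gradient f x‖ ^ 2 * w x ≤ exp K * I :=
      mul_le_mul_of_nonneg_left hC (exp_pos _).le
    exact mul_le_mul_of_nonneg_left (hB.trans this) (by positivity)
  have hE : θ * ∫ x, (f x - a) ^ 2 * w x ≤ (1 + b * exp K / lam) * I := by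
    have := mul_le_mul_of_nonneg_left hD hb
    have e : b * ((1 / lam) * (exp K * I)) = (b * exp K / lam) * I := by ring
    rw [e] at this
    linarith
  have hF : ∫ x, (f x - a) ^ 2 * w x ≤ (1 / ρ) * I := by
    have h1 : ∫ x, (f x - a) ^ 2 * w x ≤ ((1 / θ) * (1 + b * exp K / lam)) * I := by
      have : (1 / θ) * (θ * ∫ x, (f x - a) ^ 2 * w x) ≤ (1 / θ) * ((1 + b * exp K / lam) * I) :=
        mul_le_mul_of_nonneg_left hE (by positivity)
      rw [← mul_assoc, one_div_mul_cancel hθ.ne', one_mul] at this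
      linarith
    exact h1.trans (mul_le_mul_of_nonneg_right hρ hI0)
  rw [aux_gibbs_int hVc hZ, aux_gibbs_int hVc hZ]
  have := mul_le_mul_of_nonneg_left hF (inv_pos.2 (aux_Z_pos hZ)).le
  linarith

theorem aux_S0 {V : Euc d → ℝ} (hd : 0 < d) (hV : ContDiff ℝ 2 V)
    {ν : ℝ} {𝒩 : Set (Euc d) → Set (Euc d)}
    (h1 : Assumption1 V ν 𝒩) (h2 : Assumption2 V 𝒩)
    (hco : Tendsto V (cocompact (Euc d)) atTop)
    (hmin0 : ∀ x, 0 ≤ V x) (hmin : ∃ x, V x = 0)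
    {δ₀ : ℝ} (hδ₀ : 0 < δ₀)
    (hδ : ∀ x ∈ frontier (NSet V 𝒩), δ₀ ≤ infDist x (localMinSet V))
    (heb : ∀ x ∈ NSet V 𝒩, ν * infDist x (localMinSet V) ≤ ‖gradient V x‖)
    (hSc : IsCompact (localMinSet V)) {r lam : ℝ} (hr : 0 < r) (hrδ : r ≤ δ₀)
    (hUc : IsCompact {y : Euc d | infDist y (localMinSet V) ≤ r})
    (hPI : PoincareIneq (uniformOn {y : Euc d | infDist y (localMinSet V) ≤ r}) lam) :
    ∀ p ∈ localMinSet V, V p = 0 := by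
  by_contra hcon
  push Not at hcon
  obtain ⟨p, hpS, hp⟩ := hcon
  obtain ⟨q, hq⟩ := hmin
  have hqS : IsLocalMin V q := Eventually.of_forall fun y => by
    show V q ≤ V y
    rw [hq]; exact hmin0 y
  have hplt : 0 < V p := lt_of_le_of_ne (hmin0 p) (Ne.symm hp)
  rcases (Nat.succ_le_of_lt hd).eq_or_lt with hd1 | hd2
  · have hd1 : d = 1 := by omega
    subst hd1
    have hVc := hV.continuous
    set S := localMinSet V with hS
    have hloc := aux_locconst h1 hmin0
    set S0 := S ∩ {x | V x = 0} with hS0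
    set S1 := S ∩ {x | V x ≠ 0} with hS1
    have hSu : S = S0 ∪ S1 := by
      ext x
      by_cases h : V x = 0 <;> simp [hS0, hS1, h]
    have hS0c : IsClosed S0 := hSc.isClosed.inter (isClosed_eq hVc continuous_const)
    have hS1c : IsClosed S1 := by
      refine isClosed_of_closure_subset fun x hx => ?_
      have hxS : x ∈ S := hSc.isClosed.closure_subset (closure_mono inter_subset_left hx)
      refine ⟨hxS, fun h0 => ?_⟩
      obtain ⟨y, hy, hyS⟩ := (mem_closure_iff_frequently.1 hx).and_eventually (hloc x hxS) |>.exists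
      exact hy.2 ((hyS hy.1).trans h0)
    obtain ⟨x, hx0, hx1⟩ := aux_conn hr hSc (S0 := S0) (S1 := S1) ⟨q, hqS, hq⟩ ⟨p, hpS, hp⟩ hSu hUc hPI
    obtain ⟨p0, hp0, hp0d⟩ := hS0c.exists_infDist_eq_dist ⟨q, hqS, hq⟩ x
    obtain ⟨p1, hp1, hp1d⟩ := hS1c.exists_infDist_eq_dist ⟨p, hpS, hp⟩ x
    have hdist : dist p0 p1 ≤ 2 * r := by
      have := dist_triangle_left p0 p1 x
      linarith
    have hp1pos : 0 < V p1 := lt_of_le_of_ne (hmin0 p1) (Ne.symm hp1.2)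
    have hp00 : V p0 = 0 := hp0.2
    refine aux_dim1 (hV.of_le (by norm_num)) (p0 := p0) (p1 := p1) (by rw [hp00]; exact hp1pos) hp1.1 ?_
    intro t ht hg
    have hn : ‖p1 - p0‖ ≤ 2 * r := by rwa [← dist_eq_norm, dist_comm]
    have key : ∀ z ∈ S, p0 + t • (p1 - p0) ∈ closedBall z r → IsLocalMin V (p0 + t • (p1 - p0)) := by
      intro z hz hzb
      have h := aux_eb_closed hV hr ((ball_subset_ball hrδ).trans (aux_tube h1 hδ hz)) heb _ hzb
      rw [hg, norm_zero] at h
      have h0 : infDist (p0 + t • (p1 - p0)) S = 0 := by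
        apply le_antisymm _ infDist_nonneg
        by_contra hc
        push Not at hc
        have := mul_pos h1.1 hc
        linarith
      exact (hSc.isClosed.mem_iff_infDist_zero ⟨z, hz⟩).2 h0
    rcases le_total t (1 / 2) with h | h
    · apply key p0 hp0.1
      rw [mem_closedBall, dist_eq_norm, add_sub_cancel_left, norm_smul, Real.norm_of_nonneg ht.1]
      nlinarith [norm_nonneg (p1 - p0)]
    · apply key p1 hp1.1
      rw [mem_closedBall, dist_eq_norm]
      have : p0 + t • (p1 - p0) - p1 = (-(1 - t)) • (p1 - p0) := by module
      rw [this, norm_smul, norm_neg, Real.norm_of_nonneg (by linarith [ht.2])]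
      nlinarith [norm_nonneg (p1 - p0), ht.2]
  · refine aux_mp hd2 hV hco hmin0 ?_ hSc.isClosed (aux_hopen h1 hmin0) q p hqS hpS (by rw [hq]; exact hplt)
    intro x hx
    by_cases hxN : x ∈ NSet V 𝒩
    · exact Or.inl (aux_crit_min h1 hmin0 hxN hx)
    · exact Or.inr (aux_strict_max hV x hx (h2 x hxN hx))

theorem aux_lap_neg {V : Euc d → ℝ} {x : Euc d} {μm : ℝ}
    (h : ∀ v : Euc d, hessQ V x v ≤ -μm * ‖v‖ ^ 2) : lap V x ≤ -(d * μm) := by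
  unfold lap
  calc ∑ i, hessQ V x (EuclideanSpace.basisFun (Fin d) ℝ i) ≤ ∑ i : Fin d, (-μm) := by
        refine Finset.sum_le_sum fun i _ => (h _).trans (le_of_eq ?_)
        simp
    _ = _ := by simp

theorem aux_arith {ε θ M D lam E K : ℝ} (hε : 0 < ε) (hD : 0 < D) (hM : D ≤ M)
    (hlam : 0 < lam) (hθ : θ = D / (2 * ε)) (hE : 120 ≤ exp E) (hKE : K ≤ E)
    (hl : lam * ε ≤ 60 * M) :
    (1 / θ) * (1 + (θ + M / (2 * ε)) * exp K / lam) ≤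
      1 / (1 / 2 * (D / (D + M)) * exp (-E) * lam) := by
  have hM0 : 0 < M := hD.trans_le hM
  have hK : exp K ≤ exp E := exp_le_exp.2 hKE
  have hE0 := exp_pos E
  have e1 : (1 / θ) * (1 + (θ + M / (2 * ε)) * exp K / lam) =
      (2 * ε * lam + (D + M) * exp K) / (D * lam) := by
    rw [hθ]; field_simp
  have e2 : 1 / (1 / 2 * (D / (D + M)) * exp (-E) * lam) = (2 * (D + M) * exp E) / (D * lam) := by
    rw [exp_neg]; field_simp
  rw [e1, e2]
  apply div_le_div_of_nonneg_right _ (by positivity)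
  have h1 : (D + M) * exp K ≤ (D + M) * exp E := by gcongr
  have h2 : 2 * ε * lam ≤ (D + M) * exp E := by nlinarith
  linarith

theorem aux_exp16 {E : ℝ} (h : 16 ≤ E) : 120 ≤ exp E := by
  have h1 : (2 : ℝ) ^ 16 ≤ exp 16 := by
    have : exp 16 = exp 1 ^ 16 := by rw [← exp_nat_mul]; norm_num
    rw [this]
    gcongr
    linarith [add_one_le_exp (1 : ℝ)]
  have := exp_le_exp.2 h
  norm_num at h1
  linarith

/-- reduction of the Poincaré inequality for the Gibbs measure to the
Poincaré inequality of the uniform measure on `U = {dist(·,S) ≤ √(Cε)}`, with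
`C = 4M_Δ/ν²`: if the uniform measure on `U` satisfies PI(λ), then the Gibbs measure
satisfies PI with constant `(1/2)·(dμ⁻/(dμ⁻+M_Δ))·exp(-4LC)·λ`. -/
theorem gibbs_poincare_from_uniform
    {d : ℕ} (V : Euc d → ℝ) (hV : ContDiff ℝ 2 V)
    (ν : ℝ) (𝒩 : Set (Euc d) → Set (Euc d))
    (h1 : Assumption1 V ν 𝒩) (h2 : Assumption2 V 𝒩)
    (R₀ ν_eb C_g : ℝ) (h3 : Assumption3 V R₀ ν_eb C_g)
    (hmin0 : ∀ x, 0 ≤ V x) (hmin : ∃ x, V x = 0)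
    (δ₀ : ℝ) (hδ₀ : 0 < δ₀)
    (hδ : ∀ x ∈ frontier (NSet V 𝒩), δ₀ ≤ infDist x (localMinSet V))
    (hX : (localMaxSet V).Nonempty)
    (R₁ μm : ℝ) (hR₁ : 0 < R₁) (hμm : 0 < μm)
    (hhess : ∀ x : Euc d, infDist x (localMaxSet V) ≤ R₁ →
      ∀ v : Euc d, hessQ V x v ≤ -μm * ‖v‖ ^ 2)
    (g₀ : ℝ) (hg₀ : 0 < g₀)
    (hg : ∀ x : Euc d, x ∉ {y | infDist y (localMaxSet V) ≤ R₁} ∪ NSet V 𝒩 →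
      g₀ ≤ ‖gradient V x‖)
    (MΔ : ℝ) (hMΔ : ∀ x : Euc d, ‖x‖ ≤ 2 * R₀ → |lap V x| ≤ MΔ) (hMΔμ : d * μm ≤ MΔ)
    (L : ℝ) (hL : ∀ x ∈ NSet V 𝒩, ‖fderiv ℝ (gradient V) x‖ ≤ L)
    (heb : ∀ x ∈ NSet V 𝒩, ν * infDist x (localMinSet V) ≤ ‖gradient V x‖)
    (ε : ℝ) (hε : 0 < ε)
    (hZ : Integrable (fun x => exp (-V x / ε)))
    (hε1 : ε ≤ ν_eb ^ 2 / (64 * C_g)) (hε2 : ε ≤ δ₀ ^ 2 / (4 * MΔ / ν ^ 2))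
    (hε3 : ε ≤ g₀ ^ 2 / (4 * MΔ))
    (hε4 : d * μm / (2 * ε) ≤ ν_eb ^ 2 * R₀ ^ 2 / (128 * ε ^ 2))
    (lam : ℝ)
    (hPI : PoincareIneq
      (uniformOn {y : Euc d | infDist y (localMinSet V) ≤ Real.sqrt (4 * MΔ / ν ^ 2 * ε)})
      lam) :
    PoincareIneq (gibbs V ε)
      (1 / 2 * (d * μm / (d * μm + MΔ)) * exp (-(4 * L * (4 * MΔ / ν ^ 2))) * lam) := by
  rcases Nat.eq_zero_or_pos d with hd0 | hd
  · subst hd0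
    intro f hf _ _
    have := aux_gibbs_prob hZ
    have hx : ∀ x, f x - ∫ y, f y ∂(gibbs V ε) = 0 := by
      intro x
      have : ∀ y, f y = f x := fun y => by rw [Subsingleton.elim y x]
      simp_rw [this]
      simp
    simp [hx]
  obtain ⟨hR₀, hνeb, hCg, hgrow, hco, hSR⟩ := h3
  have hν := h1.1
  have hd' : (0 : ℝ) < d := by exact_mod_cast hd
  have hD : 0 < d * μm := mul_pos hd' hμm
  have hM : 0 < MΔ := hD.trans_le hMΔμ
  have hV1 : ContDiff ℝ 1 V := hV.of_le (by norm_num)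
  set S := localMinSet V with hS
  set N := NSet V 𝒩 with hN
  set r := Real.sqrt (4 * MΔ / ν ^ 2 * ε) with hrdef
  have hr2 : r ^ 2 = 4 * MΔ / ν ^ 2 * ε := Real.sq_sqrt (by positivity)
  have hr : 0 < r := Real.sqrt_pos.2 (by positivity)
  have hνr : ν ^ 2 * r ^ 2 = 4 * MΔ * ε := by rw [hr2]; field_simp
  have hrδ : r ≤ δ₀ := by
    refine Real.sqrt_le_iff.2 ⟨hδ₀.le, ?_⟩
    have hpos : 0 < 4 * MΔ / ν ^ 2 := by positivity
    have := (le_div_iff₀ hpos).1 hε2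
    linarith
  obtain ⟨q0, hq0⟩ := hmin
  have hq0S : q0 ∈ S := Eventually.of_forall fun y => by
    show V q0 ≤ V y
    rw [hq0]; exact hmin0 y
  have hSne : S.Nonempty := ⟨q0, hq0S⟩
  have hScl : IsClosed S := aux_closed hV h1 hmin0 hδ₀ hδ
  have hSc : IsCompact S := (isCompact_closedBall 0 R₀).of_isClosed_subset hScl hSR
  have hnorm : ∀ x, ‖x‖ ≤ R₀ + infDist x S ∧ ∃ q ∈ S, infDist x S = dist x q := by
    intro x
    obtain ⟨q, hq, hqd⟩ := hSc.exists_infDist_eq_dist hSne x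
    refine ⟨?_, q, hq, hqd⟩
    have hqR : ‖q‖ ≤ R₀ := by simpa using hSR hq
    have : ‖x‖ ≤ ‖q‖ + ‖x - q‖ := by
      have := norm_add_le q (x - q)
      simpa using this
    rw [hqd, dist_eq_norm]; linarith
  have hUcl : IsClosed {y : Euc d | infDist y S ≤ r} :=
    isClosed_le (continuous_infDist_pt _) continuous_const
  have hUc : IsCompact {y : Euc d | infDist y S ≤ r} := by
    refine (isCompact_closedBall (0 : Euc d) (R₀ + r)).of_isClosed_subset hUcl fun x hx => ?_
    have hx' : infDist x S ≤ r := hx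
    rw [mem_closedBall_zero_iff]
    linarith [(hnorm x).1]
  have hS0 : ∀ p ∈ S, V p = 0 := aux_S0 hd hV h1 h2 hco hmin0 ⟨q0, hq0⟩ hδ₀ hδ heb hSc hr hrδ hUc hPI
  have hSN : S ⊆ N := aux_S_sub h1
  have hNo : IsOpen N := aux_N_open h1
  have hballN : ∀ x, infDist x S < r → x ∈ N := by
    intro x hx
    obtain ⟨q, hq, hqd⟩ := (hnorm x).2
    refine aux_tube h1 hδ hq ?_
    rw [mem_ball, ← hqd]; linarith
  -- S is not everything
  set e := EuclideanSpace.basisFun (Fin d) ℝ ⟨0, hd⟩ with he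
  have hen : ‖e‖ = 1 := by simp [he]
  have hnu : S ≠ univ := by
    intro h
    have h5 : (R₀ + 1) • e ∈ S := by rw [h]; trivial
    have := hSR h5
    rw [mem_closedBall_zero_iff, norm_smul, hen, Real.norm_of_nonneg (by linarith)] at this
    linarith
  obtain ⟨p, hpS, hpν⟩ := aux_nu_le hV hScl hSne hnu hNo hSN (fun p hp => aux_grad_zero hp) heb
  have hLν : ν ≤ L := hpν.trans (hL p (hSN hpS))
  have hMν : ν ≤ MΔ := by
    have h5 := aux_norm_le_lap hV p hpS
    have h6 : ‖p‖ ≤ R₀ := by simpa using hSR hpS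
    have h7 := hMΔ p (by linarith)
    exact (hpν.trans h5).trans ((le_abs_self _).trans h7)
  -- size of the tube
  have hδR : δ₀ ≤ 2 * R₀ := by
    obtain ⟨x, hx⟩ := hX
    have hxneg := hhess x (by rw [infDist_zero_of_mem hx]; exact hR₁.le)
    have hxg : gradient V x = 0 := by
      have : IsLocalMax V x := hx
      rw [gradient, this.fderiv_eq_zero]; simp
    have hxN : x ∉ N := by
      intro hxN
      have h5 := aux_hess_nonneg hV x (aux_crit_min h1 hmin0 hxN hxg) e
      have h6 := hxneg e
      rw [hen] at h6
      linarith
    have hxR : ‖x‖ ≤ R₀ := by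
      by_contra hc
      push Not at hc
      have h5 := (hgrow x hc.le).1
      rw [hxg, norm_zero] at h5
      have h0 : infDist x S = 0 := by
        apply le_antisymm _ infDist_nonneg
        by_contra hc
        push Not at hc
        have := mul_pos hνeb hc
        linarith
      exact hxN (hSN ((hScl.mem_iff_infDist_zero hSne).2 h0))
    by_contra hc
    push Not at hc
    refine hxN (aux_tube h1 hδ hq0S ?_)
    rw [mem_ball, dist_eq_norm]
    have h6 : ‖q0‖ ≤ R₀ := by simpa using hSR hq0S
    linarith [norm_sub_le x q0]
  -- bounds on lam
  have hlow : ∀ x, infDist x S < 2 * r / 3 → ν * infDist x S ^ 2 / 8 ≤ V x := fun x hx =>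
    aux_Vlow hV hco hmin0 hSne hν (fun y hy => heb y (hballN y hy)) x hx
  obtain ⟨hlam, hlam2⟩ := aux_lam hV hr hν hM hmin0 hq0S hq0 hlow
    (fun x hx => aux_PL0 h1 hmin0 hS0 (hballN x (by linarith)))
    (fun x hx => (le_abs_self _).trans (hMΔ x (by linarith [(hnorm x).1])))
    hUc hen hPI
  have hlε : lam * ε ≤ 60 * MΔ := by
    have h5 : ν * (ν * r ^ 2 / 72) = MΔ * ε / 18 := by
      have : ν * (ν * r ^ 2 / 72) = ν ^ 2 * r ^ 2 / 72 := by ring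
      rw [this, hνr]; ring
    rw [h5] at hlam2
    have h6 : MΔ * (lam * ε) ≤ MΔ * (48 * (MΔ / 4 + ν)) := by linarith
    have h7 := le_of_mul_le_mul_left h6 hM
    linarith
  -- potential bounds
  set U := {y : Euc d | infDist y S ≤ r} with hU
  have hL0 : 0 ≤ L := hν.le.trans hLν
  have hK : ∀ x ∈ U, V x ≤ (L * (4 * MΔ / ν ^ 2)) * ε := by
    intro x hx
    obtain ⟨q, hq, hqd⟩ := (hnorm x).2
    have hx' : infDist x S ≤ r := hx
    have := aux_Vup hV hr hL0 (aux_grad_zero hq) ((ball_subset_ball hrδ).trans (aux_tube h1 hδ hq)) hL x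
      (by rw [mem_closedBall, ← hqd]; exact hx')
    rw [hS0 q hq, hr2] at this
    linarith
  have hv0 : volume U ≠ 0 := by
    have : ball q0 r ⊆ U := fun y hy => (infDist_le_dist_of_mem hq0S).trans (mem_ball.1 hy).le
    exact ((measure_ball_pos volume q0 hr).trans_le (measure_mono this)).ne'
  have hθ : 0 < d * μm / (2 * ε) := by positivity
  have hfar : ∀ x : Euc d, 2 * R₀ ≤ ‖x‖ →
      d * μm / (2 * ε) ≤ ‖gradient V x‖ ^ 2 / (4 * ε ^ 2) - lap V x / (2 * ε) := by
    intro x hx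
    obtain ⟨hg1, hg2⟩ := hgrow x (by linarith)
    have hi : ‖x‖ / 2 ≤ infDist x S := by linarith [(hnorm x).1]
    have h5 : (ν_eb * (‖x‖ / 2)) ^ 2 ≤ ‖gradient V x‖ ^ 2 := by
      have : ν_eb * (‖x‖ / 2) ≤ ‖gradient V x‖ := (mul_le_mul_of_nonneg_left hi hνeb.le).trans hg1
      gcongr
    have h6 : lap V x ≤ C_g * ‖x‖ ^ 2 := (le_abs_self _).trans hg2
    have h7 : 64 * C_g * ε ≤ ν_eb ^ 2 := by
      have := (le_div_iff₀ (by positivity)).1 hε1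
      linarith
    have h8 : (2 * R₀) ^ 2 ≤ ‖x‖ ^ 2 := by gcongr
    have h9 : lap V x / (2 * ε) ≤ ν_eb ^ 2 * ‖x‖ ^ 2 / (128 * ε ^ 2) := by
      rw [div_le_div_iff₀ (by positivity) (by positivity)]
      have h10 := mul_le_mul_of_nonneg_right h6 (by positivity : 0 ≤ 128 * ε ^ 2)
      have h11 := mul_le_mul_of_nonneg_right h7 (by positivity : 0 ≤ ‖x‖ ^ 2 * (2 * ε))
      linarith
    have h12 : ν_eb ^ 2 * ‖x‖ ^ 2 / (16 * ε ^ 2) ≤ ‖gradient V x‖ ^ 2 / (4 * ε ^ 2) := by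
      rw [div_le_div_iff₀ (by positivity) (by positivity)]
      have := mul_le_mul_of_nonneg_right h5 (by positivity : 0 ≤ 16 * ε ^ 2)
      linarith
    have h13 : ν_eb ^ 2 * R₀ ^ 2 / (128 * ε ^ 2) ≤ ν_eb ^ 2 * ‖x‖ ^ 2 / (128 * ε ^ 2) := by
      gcongr
      linarith
    have h14 : ν_eb ^ 2 * ‖x‖ ^ 2 / (16 * ε ^ 2) = 8 * (ν_eb ^ 2 * ‖x‖ ^ 2 / (128 * ε ^ 2)) := by
      rw [show (128:ℝ) * ε ^ 2 = 8 * (16 * ε ^ 2) by ring, ← mul_div_assoc, mul_div_mul_left _ _ (by norm_num : (8:ℝ) ≠ 0)]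
    have h15 : 0 ≤ ν_eb ^ 2 * ‖x‖ ^ 2 / (128 * ε ^ 2) := by positivity
    linarith
  have hbig : ∀ x : Euc d, ‖x‖ ≤ 2 * R₀ → 4 * MΔ * ε ≤ ‖gradient V x‖ ^ 2 →
      d * μm / (2 * ε) ≤ ‖gradient V x‖ ^ 2 / (4 * ε ^ 2) - lap V x / (2 * ε) := by
    intro x hx hgx
    have h5 : lap V x / (2 * ε) ≤ MΔ / (2 * ε) := by
      have := (le_abs_self _).trans (hMΔ x hx)
      gcongr
    have h6 : 2 * (MΔ / (2 * ε)) ≤ ‖gradient V x‖ ^ 2 / (4 * ε ^ 2) := by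
      rw [le_div_iff₀ (by positivity)]
      have : 2 * (MΔ / (2 * ε)) * (4 * ε ^ 2) = 4 * MΔ * ε := by field_simp
      linarith
    have h7 : d * μm / (2 * ε) ≤ MΔ / (2 * ε) := by gcongr
    linarith
  have hΨ1 : ∀ x ∉ U, d * μm / (2 * ε) ≤ ‖gradient V x‖ ^ 2 / (4 * ε ^ 2) - lap V x / (2 * ε) := by
    intro x hx
    have hxr : r < infDist x S := not_le.1 hx
    rcases le_total (2 * R₀) ‖x‖ with hx2 | hx2
    · exact hfar x hx2
    by_cases hxN : x ∈ N
    · apply hbig x hx2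
      have h5 : ν * r ≤ ‖gradient V x‖ := (mul_le_mul_of_nonneg_left hxr.le hν.le).trans (heb x hxN)
      rw [← hνr, ← mul_pow]
      gcongr
    · by_cases hxX : infDist x (localMaxSet V) ≤ R₁
      · have h5 := aux_lap_neg (hhess x hxX)
        have h6 : d * μm / (2 * ε) ≤ -(lap V x / (2 * ε)) := by
          rw [← neg_div]
          gcongr
          linarith
        have h7 : 0 ≤ ‖gradient V x‖ ^ 2 / (4 * ε ^ 2) := by positivity
        linarith
      · apply hbig x hx2
        have h5 := hg x (by rintro (h | h); exacts [hxX h, hxN h])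
        have h6 := (le_div_iff₀ (by positivity)).1 hε3
        have h7 : g₀ ^ 2 ≤ ‖gradient V x‖ ^ 2 := by gcongr
        linarith
  have hΨ2 : ∀ x, d * μm / (2 * ε) - (d * μm / (2 * ε) + MΔ / (2 * ε)) ≤
      ‖gradient V x‖ ^ 2 / (4 * ε ^ 2) - lap V x / (2 * ε) := by
    intro x
    have hMp : 0 ≤ MΔ / (2 * ε) := by positivity
    rcases le_total (2 * R₀) ‖x‖ with hx2 | hx2
    · have := hfar x hx2
      linarith
    · have h5 : lap V x / (2 * ε) ≤ MΔ / (2 * ε) := by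
        have := (le_abs_self _).trans (hMΔ x hx2)
        gcongr
      have h7 : 0 ≤ ‖gradient V x‖ ^ 2 / (4 * ε ^ 2) := by positivity
      linarith
  have hLC : 4 ≤ L * (4 * MΔ / ν ^ 2) := by
    rw [← mul_div_assoc, le_div_iff₀ (by positivity)]
    nlinarith [mul_le_mul hLν hMν hν.le hL0]
  refine aux_perturb hV hε hmin0 hZ hUc hv0 hθ (by positivity) hΨ1 hΨ2 hK hlam hPI ?_
  refine aux_arith hε hD hMΔμ hlam rfl (aux_exp16 (by linarith)) (by linarith) hlε
end
end

section
/- Let V : ℝ^d → ℝ satisfy Assumptions 1–3 with min V = 0, let δ₀, g₀, μ⁻, M_Δ, ν be the constants described in the context with the set X of local maxima nonempty, and set C = 4M_Δ/ν². Suppose ε ≤ min{ν_eb²/(64 C_g), δ₀²/C, g₀²/(4M_Δ)} and let U = {x ∈ ℝ^d : dist(x,S) ≤ √(Cε)}. Then for every x ∈ ℝ^d one has ΔV(x)/(2ε) − |∇V(x)|²/(4ε²) ≤ −σ + b·1_U(x), where σ = min{ ν_eb²R₀²/(128 ε²), dμ⁻/(2ε) } and b = σ + M_Δ/(2ε). 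-/
open MeasureTheory Real Filter Metric Set
open scoped RealInnerProductSpace ENNReal Topology

noncomputable section

variable {d : ℕ}

/-- the Lyapunov condition. Under Assumptions 1–3 and the stated
smallness conditions on `ε`, with `C = 4M_Δ/ν²`, `σ = min{ν_eb²R₀²/(128ε²), dμ⁻/(2ε)}`
and `b = σ + M_Δ/(2ε)`, one has `ΔV/(2ε) - |∇V|²/(4ε²) ≤ -σ + b·1_U` on all of `ℝ^d`,
where `U = {dist(·,S) ≤ √(Cε)}`. -/
theorem lyapunov_condition_PL
    {d : ℕ} (V : Euc d → ℝ) (hV : ContDiff ℝ 2 V)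
    (ν : ℝ) (𝒩 : Set (Euc d) → Set (Euc d))
    (h1 : Assumption1 V ν 𝒩) (h2 : Assumption2 V 𝒩)
    (R₀ ν_eb C_g : ℝ) (h3 : Assumption3 V R₀ ν_eb C_g)
    (hmin0 : ∀ x, 0 ≤ V x) (hmin : ∃ x, V x = 0)
    (δ₀ : ℝ) (hδ₀ : 0 < δ₀)
    (hδ : ∀ x ∈ frontier (NSet V 𝒩), δ₀ ≤ infDist x (localMinSet V))
    (hX : (localMaxSet V).Nonempty)
    (R₁ μm : ℝ) (hR₁ : 0 < R₁) (hμm : 0 < μm)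
    (hhess : ∀ x : Euc d, infDist x (localMaxSet V) ≤ R₁ →
      ∀ v : Euc d, hessQ V x v ≤ -μm * ‖v‖ ^ 2)
    (g₀ : ℝ) (hg₀ : 0 < g₀)
    (hg : ∀ x : Euc d, x ∉ {y | infDist y (localMaxSet V) ≤ R₁} ∪ NSet V 𝒩 →
      g₀ ≤ ‖gradient V x‖)
    (MΔ : ℝ) (hMΔ : ∀ x : Euc d, ‖x‖ ≤ 2 * R₀ → |lap V x| ≤ MΔ) (hMΔμ : d * μm ≤ MΔ)
    (heb : ∀ x ∈ NSet V 𝒩, ν * infDist x (localMinSet V) ≤ ‖gradient V x‖)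
    (ε : ℝ) (hε : 0 < ε)
    (hε1 : ε ≤ ν_eb ^ 2 / (64 * C_g)) (hε2 : ε ≤ δ₀ ^ 2 / (4 * MΔ / ν ^ 2))
    (hε3 : ε ≤ g₀ ^ 2 / (4 * MΔ)) :
    ∀ x : Euc d,
      lap V x / (2 * ε) - ‖gradient V x‖ ^ 2 / (4 * ε ^ 2)
        ≤ -(min (ν_eb ^ 2 * R₀ ^ 2 / (128 * ε ^ 2)) (d * μm / (2 * ε)))
          + {y : Euc d | infDist y (localMinSet V) ≤ Real.sqrt (4 * MΔ / ν ^ 2 * ε)}.indicator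
              (fun _ => min (ν_eb ^ 2 * R₀ ^ 2 / (128 * ε ^ 2)) (d * μm / (2 * ε))
                + MΔ / (2 * ε)) x := by
  have hM0 : 0 ≤ MΔ := (abs_nonneg _).trans (hMΔ 0 (by simpa using h3.1.le))
  obtain ⟨hR, hne, hC, hgr, -, hS⟩ := h3
  have hν := h1.1
  have hSne : (localMinSet V).Nonempty := by
    obtain ⟨z, hz⟩ := hmin
    exact ⟨z, Filter.Eventually.of_forall fun y => by rw [hz]; exact hmin0 y⟩
  intro x
  have hσ1 := min_le_left (ν_eb ^ 2 * R₀ ^ 2 / (128 * ε ^ 2)) (d * μm / (2 * ε))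
  have hσ2 := min_le_right (ν_eb ^ 2 * R₀ ^ 2 / (128 * ε ^ 2)) (d * μm / (2 * ε))
  generalize min (ν_eb ^ 2 * R₀ ^ 2 / (128 * ε ^ 2)) (d * μm / (2 * ε)) = σ at *
  have hMdiv : 0 ≤ MΔ / (2 * ε) := by positivity
  have hdM : d * μm / (2 * ε) ≤ MΔ / (2 * ε) := by gcongr
  have hgn : 0 ≤ ‖gradient V x‖ ^ 2 / (4 * ε ^ 2) := by positivity
  -- large gradient
  have key : lap V x ≤ MΔ → 4 * MΔ * ε ≤ ‖gradient V x‖ ^ 2 →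
      lap V x / (2 * ε) - ‖gradient V x‖ ^ 2 / (4 * ε ^ 2) ≤ -σ := by
    intro ha hb
    have e1 : lap V x / (2 * ε) ≤ MΔ / (2 * ε) := by gcongr
    have e2 : 4 * MΔ * ε / (4 * ε ^ 2) ≤ ‖gradient V x‖ ^ 2 / (4 * ε ^ 2) := by gcongr
    have e3 : 4 * MΔ * ε / (4 * ε ^ 2) = 2 * (MΔ / (2 * ε)) := by field_simp
    linarith
  by_cases hx : ‖x‖ ≤ 2 * R₀
  · have hl : lap V x ≤ MΔ := (le_abs_self _).trans (hMΔ x hx)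
    by_cases hU : x ∈ {y : Euc d | infDist y (localMinSet V) ≤ Real.sqrt (4 * MΔ / ν ^ 2 * ε)}
    · rw [Set.indicator_of_mem hU]
      have e1 : lap V x / (2 * ε) ≤ MΔ / (2 * ε) := by gcongr
      linarith
    · rw [Set.indicator_of_notMem hU, add_zero]
      by_cases hN : x ∈ NSet V 𝒩
      · apply key hl
        have hU2 : Real.sqrt (4 * MΔ / ν ^ 2 * ε) < infDist x (localMinSet V) := by
          simpa using hU
        have h5 := heb x hN
        have h6 : ν * Real.sqrt (4 * MΔ / ν ^ 2 * ε) ≤ ‖gradient V x‖ :=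
          (mul_le_mul_of_nonneg_left hU2.le hν.le).trans h5
        have h7 := pow_le_pow_left₀ (by positivity) h6 2
        rw [mul_pow, Real.sq_sqrt (by positivity)] at h7
        calc 4 * MΔ * ε = ν ^ 2 * (4 * MΔ / ν ^ 2 * ε) := by field_simp
          _ ≤ _ := h7
      · by_cases hXx : infDist x (localMaxSet V) ≤ R₁
        · have h8 : lap V x ≤ -(d * μm) := by
            have : lap V x ≤ ∑ i : Fin d, (-μm) := by
              apply Finset.sum_le_sum
              intro i _
              have := hhess x hXx (EuclideanSpace.basisFun (Fin d) ℝ i)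
              simpa using this
            simpa using this
          have e1 : lap V x / (2 * ε) ≤ -(d * μm) / (2 * ε) := by gcongr
          rw [neg_div] at e1
          linarith
        · apply key hl
          have h9 := hg x (by rintro (h | h); exacts [hXx h, hN h])
          have h10 := pow_le_pow_left₀ hg₀.le h9 2
          rcases hM0.eq_or_lt with h0 | h0
          · rw [← h0]; simp
          · rw [le_div_iff₀ (by positivity)] at hε3
            linarith
  · push Not at hx
    have hd : ‖x‖ / 2 ≤ infDist x (localMinSet V) := by
      rw [Metric.le_infDist hSne]
      intro y hy
      have hy' : ‖y‖ ≤ R₀ := by simpa using hS hy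
      have := norm_sub_norm_le x y
      rw [dist_eq_norm]
      linarith
    obtain ⟨ga, gb⟩ := hgr x (by linarith)
    have gc : ν_eb * (‖x‖ / 2) ≤ ‖gradient V x‖ :=
      (mul_le_mul_of_nonneg_left hd hne.le).trans ga
    have gd := pow_le_pow_left₀ (by positivity) gc 2
    have ge : lap V x ≤ C_g * ‖x‖ ^ 2 := (le_abs_self _).trans gb
    have hx2 : (2 * R₀) ^ 2 ≤ ‖x‖ ^ 2 := pow_le_pow_left₀ (by positivity) hx.le 2
    have hεC : 64 * (C_g * ε) ≤ ν_eb ^ 2 := by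
      rw [le_div_iff₀ (by positivity)] at hε1
      linarith
    have main : lap V x / (2 * ε) - ‖gradient V x‖ ^ 2 / (4 * ε ^ 2)
        ≤ -(ν_eb ^ 2 * R₀ ^ 2 / (128 * ε ^ 2)) := by
      have e1 : lap V x / (2 * ε) - ‖gradient V x‖ ^ 2 / (4 * ε ^ 2)
        + ν_eb ^ 2 * R₀ ^ 2 / (128 * ε ^ 2)
        = (64 * (lap V x * ε) - 32 * ‖gradient V x‖ ^ 2 + ν_eb ^ 2 * R₀ ^ 2)
          / (128 * ε ^ 2) := by field_simp; ring
      have e2 : (64 * (lap V x * ε) - 32 * ‖gradient V x‖ ^ 2 + ν_eb ^ 2 * R₀ ^ 2)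
          / (128 * ε ^ 2) ≤ 0 := by
        apply div_nonpos_of_nonpos_of_nonneg _ (by positivity)
        have f1 := mul_le_mul_of_nonneg_right ge hε.le
        have f2 := mul_le_mul_of_nonneg_right hεC (sq_nonneg ‖x‖)
        have f3 := mul_le_mul_of_nonneg_left hx2 (sq_nonneg ν_eb)
        have f4 : 0 ≤ ν_eb ^ 2 * R₀ ^ 2 := by positivity
        nlinarith
      linarith
    by_cases hU : x ∈ {y : Euc d | infDist y (localMinSet V) ≤ Real.sqrt (4 * MΔ / ν ^ 2 * ε)}
    · rw [Set.indicator_of_mem hU]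
      have : 0 ≤ ν_eb ^ 2 * R₀ ^ 2 / (128 * ε ^ 2) := by positivity
      linarith
    · rw [Set.indicator_of_notMem hU, add_zero]
      linarith
end
end
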